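/- arXiv:1801.10431 — 6 statements merged into one kernel-verified Lean document; each statement's English description precedes it below -/
import Mathlib

section
/- There exist a real constant c > 0, a constant C > 0 and a positive integer n₀ such that for every finite set A of real numbers with |A| ≥ n₀, at least one of |AA+A| ≥ C·|A|^(3/2 + c) and |AA−A| ≥ C·|A|^(3/2 + c) holds; in particular max(|AA+A|, |AA−A|) ≥ C·|A|^(3/2 + c). -/
section SumProduct
open Finset

/-- Few members of a family of disjoint half-open intervals contain many points of `Z`. -/
lemma card_long_intervals_le (G Z : Finset ℝ) (a b : ℝ → ℝ)
    (h : ∀ x ∈ G, ∀ x' ∈ G, x < x' → b x ≤ a x') (R : ℕ) :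
    #{x ∈ G | #Z < R * #{z ∈ Z | a x < z ∧ z ≤ b x}} ≤ R := by
  set B := {x ∈ G | #Z < R * #{z ∈ Z | a x < z ∧ z ≤ b x}} with hB
  rcases Nat.eq_zero_or_pos #Z with hZ | hZ
  · have : B = ∅ := by
      rw [hB, filter_eq_empty_iff]
      intro x _ hx
      rw [card_eq_zero.mp hZ] at hx
      simp at hx
    simp [this]
  have hdisj : (B : Set ℝ).PairwiseDisjoint (fun x => {z ∈ Z | a x < z ∧ z ≤ b x}) := by
    intro x hx x' hx' hne
    have hxG : x ∈ G := (mem_filter.mp hx).1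
    have hxG' : x' ∈ G := (mem_filter.mp hx').1
    refine Finset.disjoint_left.mpr fun z hz hz' => ?_
    simp only [mem_filter] at hz hz'
    rcases lt_or_gt_of_ne hne with hlt | hlt
    · have := h x hxG x' hxG' hlt
      linarith [hz.2.2, hz'.2.1]
    · have := h x' hxG' x hxG hlt
      linarith [hz.2.1, hz'.2.2]
  have h1 : ∑ x ∈ B, #{z ∈ Z | a x < z ∧ z ≤ b x} ≤ #Z := by
    rw [← card_biUnion hdisj]
    exact card_le_card (biUnion_subset.mpr fun x _ => filter_subset _ _)
  have h2 : #B * #Z ≤ R * ∑ x ∈ B, #{z ∈ Z | a x < z ∧ z ≤ b x} := by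
    rw [mul_sum, ← smul_eq_mul]
    exact card_nsmul_le_sum _ _ _ fun x hx => (mem_filter.mp hx).2.le
  exact Nat.le_of_mul_le_mul_right (h2.trans (Nat.mul_le_mul_left R h1)) hZ

/-- Pairs of points of `X` in increasing order with few points of `X` between them. -/
noncomputable def closePairs (X : Finset ℝ) (R : ℕ) : Finset (ℝ × ℝ) :=
  {p ∈ X ×ˢ X | p.1 < p.2 ∧ R * #{z ∈ X | p.1 < z ∧ z ≤ p.2} ≤ #X}

lemma mul_card_closePairs_le (X : Finset ℝ) (R : ℕ) : R * #(closePairs X R) ≤ #X ^ 2 := by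
  have hsum : #(closePairs X R) = ∑ x ∈ X, #{p ∈ closePairs X R | p.1 = x} :=
    card_eq_sum_card_fiberwise fun p hp => by
      simp only [closePairs, coe_filter, mem_product, Set.mem_ofPred_eq] at hp
      exact hp.1.1
  rw [hsum, mul_sum, sq, ← smul_eq_mul (#X) (#X)]
  refine sum_le_card_nsmul _ _ _ fun x _ => ?_
  set F := {p ∈ closePairs X R | p.1 = x} with hF
  rcases F.eq_empty_or_nonempty with h0 | hne
  · simp [h0]
  obtain ⟨p, hp, hmax⟩ := F.exists_max_image (fun p => p.2) hne
  have hpF := hp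
  simp only [hF, closePairs, mem_filter, mem_product] at hp
  have : #F ≤ #{z ∈ X | p.1 < z ∧ z ≤ p.2} := by
    refine card_le_card_of_injOn (fun q => q.2) ?_ ?_
    · intro q hq
      have hq' := hmax q hq
      simp only [hF, closePairs, coe_filter, mem_filter, mem_product, Set.mem_ofPred_eq] at hq ⊢
      refine ⟨hq.1.1.2, ?_, hq'⟩
      rw [hp.2, ← hq.2]
      exact hq.1.2.1
    · intro q hq q' hq' heq
      simp only [hF, coe_filter, Set.mem_ofPred_eq] at hq hq'
      exact Prod.ext (hq.2.trans hq'.2.symm) heq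
  exact (Nat.mul_le_mul_left R this).trans hp.1.2.2

lemma card_le_add_card_closePairs_on_line (X Y : Finset ℝ) (m b : ℝ) (hm : 0 < m) (R : ℕ) :
    #{x ∈ X | m * x + b ∈ Y} ≤ 2 * R + 1 +
      #{p ∈ closePairs X R ×ˢ closePairs Y R | p.2.1 = m * p.1.1 + b ∧
        p.2.2 = m * p.1.2 + b} := by
  classical
  set G := {x ∈ X | m * x + b ∈ Y} with hG
  set G' := {x ∈ G | ∃ x' ∈ G, x < x'} with hG'
  have hs : ∀ x : ℝ, ∃ y : ℝ, x ∈ G' → y ∈ G ∧ x < y ∧ ∀ x' ∈ G, x < x' → y ≤ x' := by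
    intro x
    by_cases hx : x ∈ G'
    · obtain ⟨_, x', hx', hlt⟩ := mem_filter.mp hx
      obtain ⟨y, hy, hmin⟩ := {z ∈ G | x < z}.exists_min_image id
        ⟨x', mem_filter.mpr ⟨hx', hlt⟩⟩
      exact ⟨y, fun _ => ⟨(mem_filter.mp hy).1, (mem_filter.mp hy).2, fun z hz hxz =>
        hmin z (mem_filter.mpr ⟨hz, hxz⟩)⟩⟩
    · exact ⟨x, fun h => absurd h hx⟩
  choose s hs using hs
  have hlast : #(G \ G') ≤ 1 := by
    refine card_le_one.mpr fun x hx y hy => ?_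
    simp only [hG', mem_sdiff, mem_filter, not_and, not_exists, not_lt] at hx hy
    exact le_antisymm (hy.2 hy.1 x hx.1) (hx.2 hx.1 y hy.1)
  have hG'G : G' ⊆ G := filter_subset _ _
  have hlongX := card_long_intervals_le G' X id s
    (fun x hx x' hx' hlt => (hs x hx).2.2 x' (hG'G hx') hlt) R
  have hlongY := card_long_intervals_le G' Y (fun x => m * x + b) (fun x => m * s x + b)
    (fun x hx x' hx' hlt => by
      have := (hs x hx).2.2 x' (hG'G hx') hlt
      nlinarith) R
  set LX := {x ∈ G' | #X < R * #{z ∈ X | id x < z ∧ z ≤ s x}} with hLX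
  set LY := {x ∈ G' | #Y < R * #{z ∈ Y | m * x + b < z ∧ z ≤ m * s x + b}} with hLY
  set P := {p ∈ closePairs X R ×ˢ closePairs Y R | p.2.1 = m * p.1.1 + b ∧
        p.2.2 = m * p.1.2 + b} with hP
  have hC : #((G' \ LX) \ LY) ≤ #P := by
    refine card_le_card_of_injOn (fun x => ((x, s x), (m * x + b, m * s x + b))) ?_ ?_
    · intro x hx
      simp only [coe_sdiff, Set.mem_sdiff, mem_coe] at hx
      obtain ⟨⟨hx, hxX⟩, hxY⟩ := hx
      have hxG := hG'G hx
      obtain ⟨h1, h2, -⟩ := hs x hx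
      simp only [hLX, hLY, mem_filter, hx, true_and, not_lt, id] at hxX hxY
      simp only [hG, mem_filter] at hxG h1
      simp only [hP, closePairs, mem_coe, mem_filter, mem_product, and_true]
      refine ⟨⟨⟨hxG.1, h1.1⟩, h2, hxX⟩, ⟨hxG.2, h1.2⟩, ?_, hxY⟩
      nlinarith
    · intro x _ y _ hxy
      exact congrArg (fun q => q.1.1) hxy
  have e1 : #G ≤ #(G \ G') + #G' := by
    have := card_sdiff_add_card_eq_card hG'G
    omega
  have e2 : #G' ≤ #(G' \ LX) + #LX := by
    have := le_card_sdiff LX G'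
    omega
  have e3 : #(G' \ LX) ≤ #((G' \ LX) \ LY) + #LY := by
    have := le_card_sdiff LY (G' \ LX)
    omega
  omega

lemma grid_incidences_of_pos (X Y : Finset ℝ) (L : Finset (ℝ × ℝ)) (hL : ∀ l ∈ L, 0 < l.1)
    (R : ℕ) :
    R ^ 2 * ∑ l ∈ L, #{x ∈ X | l.1 * x + l.2 ∈ Y} ≤
      R ^ 2 * (2 * R + 1) * #L + (#X * #Y) ^ 2 := by
  classical
  have h1 : ∑ l ∈ L, #{x ∈ X | l.1 * x + l.2 ∈ Y} ≤ ∑ l ∈ L, (2 * R + 1 +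
      #{p ∈ closePairs X R ×ˢ closePairs Y R | p.2.1 = l.1 * p.1.1 + l.2 ∧
        p.2.2 = l.1 * p.1.2 + l.2}) :=
    sum_le_sum fun l hl => card_le_add_card_closePairs_on_line X Y l.1 l.2 (hL l hl) R
  rw [sum_add_distrib, sum_const, smul_eq_mul] at h1
  have h2 : ∑ l ∈ L, #{p ∈ closePairs X R ×ˢ closePairs Y R | p.2.1 = l.1 * p.1.1 + l.2 ∧
        p.2.2 = l.1 * p.1.2 + l.2} ≤ #(closePairs X R ×ˢ closePairs Y R) := by
    rw [← card_biUnion]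
    · exact card_le_card (biUnion_subset.mpr fun x _ => filter_subset _ _)
    · intro l _ l' _ hne
      refine Finset.disjoint_left.mpr fun p hp hp' => hne ?_
      simp only [closePairs, mem_filter, mem_product] at hp hp'
      obtain ⟨⟨⟨-, hlt, -⟩, -⟩, e1, e2⟩ := hp
      obtain ⟨-, e3, e4⟩ := hp'
      have hm : (l.1 - l'.1) * (p.1.2 - p.1.1) = 0 := by linarith
      have hm' : l.1 = l'.1 := by
        rcases mul_eq_zero.mp hm with h | h <;> linarith
      refine Prod.ext hm' ?_
      rw [hm'] at e1
      linarith
  rw [card_product] at h2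
  have hX := mul_card_closePairs_le X R
  have hY := mul_card_closePairs_le Y R
  calc _ ≤ R ^ 2 * (#L * (2 * R + 1) + #(closePairs X R) * #(closePairs Y R)) :=
        Nat.mul_le_mul_left _ (h1.trans (Nat.add_le_add_left h2 _))
    _ = R ^ 2 * (2 * R + 1) * #L + (R * #(closePairs X R)) * (R * #(closePairs Y R)) := by ring
    _ ≤ R ^ 2 * (2 * R + 1) * #L + #X ^ 2 * #Y ^ 2 := by gcongr
    _ = _ := by ring

/-- Szemerédi–Trotter bound for the incidences between a grid and lines `y = m x + b`. -/
lemma grid_incidences (X Y : Finset ℝ) (L : Finset (ℝ × ℝ)) (hL : ∀ l ∈ L, l.1 ≠ 0) (R : ℕ) :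
    R ^ 2 * ∑ l ∈ L, #{x ∈ X | l.1 * x + l.2 ∈ Y} ≤
      R ^ 2 * (2 * R + 1) * #L + 2 * (#X * #Y) ^ 2 := by
  classical
  have hneg := grid_incidences_of_pos X (Y.image Neg.neg) ({l ∈ L | ¬ 0 < l.1}.image Neg.neg)
    (by
      intro l hl
      obtain ⟨l', hl', rfl⟩ := mem_image.mp hl
      obtain ⟨hl', hlt⟩ := mem_filter.mp hl'
      have := hL l' hl'
      simp only [Prod.fst_neg, Left.neg_pos_iff]
      exact lt_of_le_of_ne (not_lt.mp hlt) this) R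
  have hpos := grid_incidences_of_pos X Y {l ∈ L | 0 < l.1} (fun l hl => (mem_filter.mp hl).2) R
  rw [card_image_of_injective _ neg_injective, card_image_of_injective _ neg_injective,
    sum_image neg_injective.injOn] at hneg
  have e : ∀ l : ℝ × ℝ, #{x ∈ X | (-l).1 * x + (-l).2 ∈ Y.image Neg.neg} =
      #{x ∈ X | l.1 * x + l.2 ∈ Y} := by
    intro l
    congr 1
    refine filter_congr fun x _ => ?_
    simp only [mem_image, Prod.fst_neg, Prod.snd_neg]
    constructor
    · rintro ⟨y, hy, h⟩
      have : l.1 * x + l.2 = y := by linarith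
      rwa [this]
    · intro h
      exact ⟨_, h, by ring⟩
  simp only [e] at hneg
  rw [← sum_filter_add_sum_filter_not L (fun l => 0 < l.1)]
  have hcard := card_filter_add_card_filter_not (s := L) (fun l => 0 < l.1)
  rw [← hcard]
  nlinarith

lemma sum_card_filter_eq_card_filter_product {ι α : Type*} (L : Finset ι) (X : Finset α)
    (p : ι → α → Prop) [∀ i x, Decidable (p i x)] :
    ∑ l ∈ L, #{x ∈ X | p l x} = #{q ∈ L ×ˢ X | p q.1 q.2} := by
  simp only [card_filter, sum_product]

lemma grid_incidences_le (X Y : Finset ℝ) (L : Finset (ℝ × ℝ)) (hL : ∀ l ∈ L, l.1 ≠ 0)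
    (x : ℝ) (hx : 1 ≤ x) :
    (#{q ∈ L ×ˢ X | q.1.1 * q.2 + q.1.2 ∈ Y} : ℝ) ≤
      3 * x * #L + 8 * ((#X : ℝ) * #Y) ^ 2 / x ^ 2 := by
  have h := grid_incidences X Y L hL ⌊x⌋₊
  rw [sum_card_filter_eq_card_filter_product L X (fun l x => l.1 * x + l.2 ∈ Y)] at h
  set R := ⌊x⌋₊ with hR
  have hR1 : (1 : ℝ) ≤ R := by exact_mod_cast Nat.le_floor (by simpa using hx)
  have hRx : (R : ℝ) ≤ x := Nat.floor_le (by linarith)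
  have hxR : x ≤ 2 * R := by
    have := Nat.lt_floor_add_one x
    rw [← hR] at this
    linarith
  set I := #{q ∈ L ×ˢ X | q.1.1 * q.2 + q.1.2 ∈ Y}
  have h' : (R : ℝ) ^ 2 * I ≤ R ^ 2 * (2 * R + 1) * #L + 2 * ((#X : ℝ) * #Y) ^ 2 := by
    exact_mod_cast h
  have h1 : (I : ℝ) ≤ (2 * R + 1) * #L + 2 * ((#X : ℝ) * #Y) ^ 2 / R ^ 2 := by
    have hR2 : (0 : ℝ) < (R : ℝ) ^ 2 := by positivity
    rw [← sub_le_iff_le_add', le_div_iff₀ hR2]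
    linarith
  refine h1.trans (add_le_add ?_ ?_)
  · gcongr
    linarith
  · rw [div_le_div_iff₀ (by positivity) (by positivity)]
    have : x ^ 2 ≤ (2 * R) ^ 2 := by gcongr
    nlinarith [sq_nonneg ((#X : ℝ) * #Y)]

lemma grid_card_le_of_incidences (X Y : Finset ℝ) (L : Finset (ℝ × ℝ)) (hL : ∀ l ∈ L, l.1 ≠ 0)
    (H n : ℝ) (hH : 1 ≤ H) (hn : 0 < n) (hLn : (#L : ℝ) ≤ H * n ^ 2)
    (hI : (#X : ℝ) * #Y * n ≤ H * #{q ∈ L ×ˢ X | q.1.1 * q.2 + q.1.2 ∈ Y}) :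
    (#X : ℝ) * #Y ≤ 576 * H ^ 5 * n := by
  set p : ℝ := (#X : ℝ) * #Y with hp
  have hp0 : 0 ≤ p := by positivity
  by_cases hx : 1 ≤ p / (6 * H ^ 2 * n)
  · have h := grid_incidences_le X Y L hL _ hx
    rw [← hp] at h
    have hpp : 0 < p := by
      rcases hp0.eq_or_lt with h0 | h0
      · rw [← h0] at hx
        norm_num at hx
      · exact h0
    have h1 : 3 * (p / (6 * H ^ 2 * n)) * #L ≤ p * n / (2 * H) := by
      calc 3 * (p / (6 * H ^ 2 * n)) * #L ≤ 3 * (p / (6 * H ^ 2 * n)) * (H * n ^ 2) := by gcongr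
        _ = p * n / (2 * H) := by field_simp; ring
    have h2 : 8 * p ^ 2 / (p / (6 * H ^ 2 * n)) ^ 2 = 288 * H ^ 4 * n ^ 2 := by
      field_simp
      ring
    rw [h2] at h
    have h3 : p * n ≤ H * (p * n / (2 * H) + 288 * H ^ 4 * n ^ 2) :=
      hI.trans (mul_le_mul_of_nonneg_left (h.trans (by linarith)) (by linarith))
    have h4 : H * (p * n / (2 * H) + 288 * H ^ 4 * n ^ 2) =
        (p / 2 + 288 * H ^ 5 * n) * n := by field_simp
    rw [h4] at h3
    have := le_of_mul_le_mul_right h3 hn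
    linarith
  · rw [not_le, div_lt_one (by positivity)] at hx
    have : H ^ 2 ≤ H ^ 5 := pow_le_pow_right₀ hH (by norm_num)
    nlinarith

lemma sq_card_le_card_image_mul_energy {ι β : Type*} [DecidableEq β] (s : Finset ι)
    (f : ι → β) :
    #s ^ 2 ≤ #(s.image f) * #{q ∈ s ×ˢ s | f q.1 = f q.2} := by
  have h1 : #s = ∑ b ∈ s.image f, #{a ∈ s | f a = b} :=
    card_eq_sum_card_image f s
  have h2 : #{q ∈ s ×ˢ s | f q.1 = f q.2} = ∑ b ∈ s.image f, #{a ∈ s | f a = b} ^ 2 := by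
    rw [card_eq_sum_card_fiberwise (f := fun q : ι × ι => f q.1) (t := s.image f)]
    · refine sum_congr rfl fun b _ => ?_
      rw [sq, ← card_product]
      congr 1
      ext q
      simp only [mem_filter, mem_product]
      constructor
      · rintro ⟨⟨⟨h1, h2⟩, h3⟩, h4⟩
        exact ⟨⟨h1, h4⟩, h2, h3 ▸ h4⟩
      · rintro ⟨⟨h1, h4⟩, h2, h3⟩
        exact ⟨⟨⟨h1, h2⟩, h4.trans h3.symm⟩, h4⟩
    · intro q hq
      simp only [coe_filter, mem_product, Set.mem_ofPred_eq] at hq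
      exact mem_coe.mpr (mem_image_of_mem f hq.1.1)
  rw [h2]
  conv_lhs => rw [h1]
  exact sq_sum_le_card_mul_sum_sq

lemma mul_card_le_mul_card_popular {ι : Type*} (s : Finset ι) (f : ι → ℕ) (B t : ℝ)
    (hB : ∀ i ∈ s, (f i : ℝ) ≤ B) (ht : 0 ≤ t)
    (hsum : 2 * t * #s ≤ ∑ i ∈ s, (f i : ℝ)) :
    t * #s ≤ B * #{i ∈ s | t ≤ (f i : ℝ)} := by
  have h1 : ∑ i ∈ s with t ≤ (f i : ℝ), (f i : ℝ) ≤ #{i ∈ s | t ≤ (f i : ℝ)} • B :=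
    sum_le_card_nsmul _ _ _ fun i hi => hB i (mem_filter.mp hi).1
  have h2 : ∑ i ∈ s with ¬ t ≤ (f i : ℝ), (f i : ℝ) ≤ #{i ∈ s | ¬ t ≤ (f i : ℝ)} • t :=
    sum_le_card_nsmul _ _ _ fun i hi => (not_le.mp (mem_filter.mp hi).2).le
  have h3 : (#{i ∈ s | ¬ t ≤ (f i : ℝ)} : ℝ) ≤ #s := by exact_mod_cast card_filter_le _ _
  rw [← sum_filter_add_sum_filter_not s (fun i => t ≤ (f i : ℝ))] at hsum
  rw [nsmul_eq_mul] at h1 h2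
  nlinarith

/-- A set with many multiplicative almost-periods has few popular differences. -/
lemma card_popular_differences_le (A V D : Finset ℝ) (hA : ∀ a ∈ A, 0 < a) (hVA : V ⊆ A)
    (H : ℝ) (hH : 1 ≤ H) (hA0 : A.Nonempty)
    (hAV : (#(image₂ (· * ·) A V) : ℝ) ≤ H * #A)
    (hD : ∀ d ∈ D, (#A : ℝ) ≤ H * #{c ∈ A | c + d ∈ A}) :
    (#V : ℝ) * #D ≤ 576 * H ^ 5 * #A := by
  classical
  have hn : (0 : ℝ) < #A := by exact_mod_cast hA0.card_pos
  set X := V.image (fun v => v⁻¹) with hX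
  have hXc : #X = #V := card_image_of_injective _ inv_injective
  set L := (image₂ (· * ·) A V ×ˢ A).image (fun q : ℝ × ℝ => (q.1, -q.2)) with hL
  have hLc : (#L : ℝ) ≤ H * (#A : ℝ) ^ 2 := by
    have : #L ≤ #(image₂ (· * ·) A V) * #A := card_image_le.trans (card_product _ _).le
    have : (#L : ℝ) ≤ #(image₂ (· * ·) A V) * #A := by exact_mod_cast this
    nlinarith
  rw [← hXc]
  refine grid_card_le_of_incidences X D L ?_ H (#A) hH hn hLc ?_
  · intro l hl
    obtain ⟨q, hq, rfl⟩ := mem_image.mp hl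
    obtain ⟨a, ha, v, hv, h⟩ := mem_image₂.mp (mem_product.mp hq).1
    dsimp only at h ⊢
    rw [← h]
    exact (mul_pos (hA a ha) (hA v (hVA hv))).ne'
  · have hlow : #V * ∑ d ∈ D, #{c ∈ A | c + d ∈ A} ≤
        #{q ∈ L ×ˢ X | q.1.1 * q.2 + q.1.2 ∈ D} := by
      rw [sum_card_filter_eq_card_filter_product D A (fun d c => c + d ∈ A), ← card_product]
      refine card_le_card_of_injOn
        (fun q : ℝ × ℝ × ℝ => (((q.2.2 + q.2.1) * q.1, -q.2.2), q.1⁻¹)) ?_ ?_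
      · rintro ⟨v, d, c⟩ hq
        simp only [coe_product, coe_filter, mem_product, Set.mem_prod, mem_coe,
          Set.mem_ofPred_eq] at hq
        obtain ⟨hv, ⟨hd, hc⟩, hcd⟩ := hq
        have hv0 := (hA v (hVA hv)).ne'
        simp only [mem_coe, mem_filter, mem_product]
        refine ⟨⟨mem_image.mpr ⟨((c + d) * v, c), mem_product.mpr
          ⟨mem_image₂_of_mem hcd hv, hc⟩, rfl⟩, mem_image_of_mem _ hv⟩, ?_⟩
        have : (c + d) * v * v⁻¹ + -c = d := by field_simp; ring
        rwa [this]
      · rintro ⟨v, d, c⟩ hq ⟨v', d', c'⟩ hq' h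
        simp only [coe_product, coe_filter, mem_product, Set.mem_prod, mem_coe,
          Set.mem_ofPred_eq] at hq hq'
        have hv0 := (hA v (hVA hq.1)).ne'
        simp only [Prod.mk.injEq, neg_inj, inv_inj] at h
        obtain ⟨⟨h1, rfl⟩, rfl⟩ := h
        have := mul_right_cancel₀ hv0 h1
        have : d = d' := by linarith
        rw [this]
    have hlow' : (#V : ℝ) * ∑ d ∈ D, (#{c ∈ A | c + d ∈ A} : ℝ) ≤
        #{q ∈ L ×ˢ X | q.1.1 * q.2 + q.1.2 ∈ D} := by exact_mod_cast hlow
    have h2 : (#D : ℝ) * #A ≤ H * ∑ d ∈ D, (#{c ∈ A | c + d ∈ A} : ℝ) := by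
      rw [mul_sum, ← nsmul_eq_mul]
      exact card_nsmul_le_sum _ _ _ hD
    rw [hXc]
    calc (#V : ℝ) * #D * #A = #V * (#D * #A) := by ring
      _ ≤ #V * (H * ∑ d ∈ D, (#{c ∈ A | c + d ∈ A} : ℝ)) := by gcongr
      _ = H * (#V * ∑ d ∈ D, (#{c ∈ A | c + d ∈ A} : ℝ)) := by ring
      _ ≤ _ := by gcongr

/-- A set with many additive almost-periods has few popular ratios. -/
lemma card_popular_ratios_le (A B V P : Finset ℝ) (κ : ℝ) (hκ : κ ≠ 0)
    (hA : ∀ a ∈ A, 0 < a) (hBA : B ⊆ A) (hA0 : A.Nonempty) (hP0 : ∀ p ∈ P, p ≠ 0)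
    (s H : ℝ) (hH : 1 ≤ H) (hB : ∀ c ∈ B, s ≤ #{w ∈ V | c + κ * w ∈ A})
    (hP : ∀ p ∈ P, (#V : ℝ) * #A ≤ H * (s * #{c ∈ B | p * c ∈ B})) :
    (#P : ℝ) * #V ≤ 576 * H ^ 5 * #A := by
  classical
  have hn : (0 : ℝ) < #A := by exact_mod_cast hA0.card_pos
  set X := P.image (fun v => v⁻¹) with hX
  have hXc : #X = #P := card_image_of_injective _ inv_injective
  set Y := V.image (fun v => κ * v) with hY
  have hYc : #Y = #V := card_image_of_injective _ (mul_right_injective₀ hκ)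
  set L := (A ×ˢ A).image (fun q : ℝ × ℝ => (-q.1, q.2)) with hL
  have hLc : (#L : ℝ) ≤ H * (#A : ℝ) ^ 2 := by
    have : #L ≤ #A * #A := card_image_le.trans (card_product _ _).le
    have : (#L : ℝ) ≤ #A * #A := by exact_mod_cast this
    nlinarith
  rw [← hXc, ← hYc]
  refine grid_card_le_of_incidences X Y L ?_ H (#A) hH hn hLc ?_
  · intro l hl
    obtain ⟨q, hq, rfl⟩ := mem_image.mp hl
    exact neg_ne_zero.mpr (hA _ (mem_product.mp hq).1).ne'
  · have hlow : ∑ p ∈ P, ∑ c ∈ B with p * c ∈ B, #{w ∈ V | c + κ * w ∈ A} ≤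
        #{q ∈ L ×ˢ X | q.1.1 * q.2 + q.1.2 ∈ Y} := by
      have e : ∑ p ∈ P, ∑ c ∈ B with p * c ∈ B, #{w ∈ V | c + κ * w ∈ A} =
          #{q ∈ P ×ˢ B ×ˢ V | q.1 * q.2.1 ∈ B ∧ q.2.1 + κ * q.2.2 ∈ A} := by
        rw [← sum_card_filter_eq_card_filter_product P (B ×ˢ V)
          (fun p q => p * q.1 ∈ B ∧ q.1 + κ * q.2 ∈ A)]
        refine sum_congr rfl fun p _ => ?_
        rw [sum_card_filter_eq_card_filter_product _ V (fun c w => c + κ * w ∈ A)]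
        congr 1
        ext q
        simp only [mem_filter, mem_product]
        tauto
      rw [e]
      refine card_le_card_of_injOn
        (fun q : ℝ × ℝ × ℝ => ((-(q.1 * q.2.1), q.2.1 + κ * q.2.2), q.1⁻¹)) ?_ ?_
      · rintro ⟨p, c, w⟩ hq
        simp only [coe_filter, mem_product, Set.mem_ofPred_eq] at hq
        obtain ⟨⟨hp, hc, hw⟩, hpc, hcw⟩ := hq
        have hp0 := hP0 p hp
        simp only [mem_coe, mem_filter, mem_product]
        refine ⟨⟨mem_image.mpr ⟨(p * c, c + κ * w), mem_product.mpr
          ⟨hBA hpc, hcw⟩, rfl⟩, mem_image_of_mem _ hp⟩, ?_⟩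
        have : -(p * c) * p⁻¹ + (c + κ * w) = κ * w := by field_simp; ring
        rw [this]
        exact mem_image_of_mem _ hw
      · rintro ⟨p, c, w⟩ hq ⟨p', c', w'⟩ hq' h
        simp only [coe_filter, mem_product, Set.mem_ofPred_eq] at hq hq'
        have hp0 := hP0 p hq.1.1
        simp only [Prod.mk.injEq, neg_inj, inv_inj] at h
        obtain ⟨⟨h1, h2⟩, rfl⟩ := h
        obtain rfl := mul_left_cancel₀ hp0 h1
        have := mul_left_cancel₀ hκ (add_left_cancel h2)
        rw [this]
    have hlow' : ∑ p ∈ P, ∑ c ∈ B with p * c ∈ B, (#{w ∈ V | c + κ * w ∈ A} : ℝ) ≤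
        #{q ∈ L ×ˢ X | q.1.1 * q.2 + q.1.2 ∈ Y} := by exact_mod_cast hlow
    have h2 : (#P : ℝ) * (#V * #A) ≤
        ∑ p ∈ P, H * ∑ c ∈ B with p * c ∈ B, (#{w ∈ V | c + κ * w ∈ A} : ℝ) := by
      rw [← nsmul_eq_mul]
      refine card_nsmul_le_sum _ _ _ fun p hp => (hP p hp).trans ?_
      refine mul_le_mul_of_nonneg_left ?_ (by linarith)
      rw [mul_comm, ← nsmul_eq_mul]
      exact card_nsmul_le_sum _ _ _ fun c hc => hB c (mem_filter.mp hc).1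
    rw [← mul_sum] at h2
    rw [hXc, hYc, mul_assoc]
    exact h2.trans (by gcongr)

lemma elekes_incidences (V D P : Finset ℝ) (κ : ℝ) (hκ : κ ≠ 0) (hV : ∀ v ∈ V, 0 < v)
    (E : Finset (ℝ × ℝ)) (hEV : E ⊆ V ×ˢ V) (hEP : ∀ e ∈ E, e.1 / e.2 ∈ P) (s : ℝ)
    (hED : ∀ e ∈ E, s ≤ #{b ∈ V | κ * (e.1 - b) ∈ D}) (x : ℝ) (hx : 1 ≤ x) :
    #E * s ≤ 3 * x * (#V : ℝ) ^ 2 + 8 * ((#D : ℝ) * #P) ^ 2 / x ^ 2 := by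
  classical
  set L := (V ×ˢ V).image (fun q : ℝ × ℝ => (1 / (κ * q.1), q.2 / q.1)) with hL
  have hLc : (#L : ℝ) ≤ (#V : ℝ) ^ 2 := by
    have : #L ≤ #V * #V := card_image_le.trans (card_product _ _).le
    rw [sq]
    exact_mod_cast this
  have h0 : ∀ l ∈ L, l.1 ≠ 0 := by
    intro l hl
    obtain ⟨q, hq, rfl⟩ := mem_image.mp hl
    have := (hV _ (mem_product.mp hq).1).ne'
    exact one_div_ne_zero (mul_ne_zero hκ this)
  have h1 := grid_incidences_le D P L h0 x hx
  have h2 : ∑ e ∈ E, #{b ∈ V | κ * (e.1 - b) ∈ D} ≤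
      #{q ∈ L ×ˢ D | q.1.1 * q.2 + q.1.2 ∈ P} := by
    rw [sum_card_filter_eq_card_filter_product E V (fun e b => κ * (e.1 - b) ∈ D)]
    refine card_le_card_of_injOn
      (fun q : (ℝ × ℝ) × ℝ => ((1 / (κ * q.1.2), q.2 / q.1.2), κ * (q.1.1 - q.2))) ?_ ?_
    · rintro ⟨⟨c, a⟩, b⟩ hq
      simp only [coe_filter, mem_product, Set.mem_ofPred_eq] at hq
      obtain ⟨⟨hca, hb⟩, hD⟩ := hq
      have hca' := mem_product.mp (hEV hca)
      have ha0 := (hV a hca'.2).ne'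
      have hP := hEP _ hca
      simp only [mem_coe, mem_filter, mem_product]
      refine ⟨⟨mem_image.mpr ⟨(a, b), mem_product.mpr ⟨hca'.2, hb⟩, rfl⟩, hD⟩, ?_⟩
      have : 1 / (κ * a) * (κ * (c - b)) + b / a = c / a := by field_simp; ring
      rwa [this]
    · rintro ⟨⟨c, a⟩, b⟩ hq ⟨⟨c', a'⟩, b'⟩ hq' h
      simp only [coe_filter, mem_product, Set.mem_ofPred_eq] at hq hq'
      have ha0 := (hV a (mem_product.mp (hEV hq.1.1)).2).ne'
      simp only [Prod.mk.injEq, one_div, inv_inj] at h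
      obtain ⟨⟨h1, h2⟩, h3⟩ := h
      obtain rfl := mul_left_cancel₀ hκ h1
      rw [div_left_inj' ha0] at h2
      subst h2
      have := mul_left_cancel₀ hκ h3
      have : c = c' := by linarith
      rw [this]
  have h2' : ∑ e ∈ E, (#{b ∈ V | κ * (e.1 - b) ∈ D} : ℝ) ≤
      #{q ∈ L ×ˢ D | q.1.1 * q.2 + q.1.2 ∈ P} := by exact_mod_cast h2
  have h3 : #E * s ≤ ∑ e ∈ E, (#{b ∈ V | κ * (e.1 - b) ∈ D} : ℝ) := by
    rw [← nsmul_eq_mul]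
    exact card_nsmul_le_sum _ _ _ hED
  refine (h3.trans h2').trans (h1.trans ?_)
  gcongr

/-- If `κ V` consists mostly of popular differences of `A`, then most pairs of elements of `V`
differ by a multiple of a popular difference. -/
lemma many_popular_differences (A V : Finset ℝ) (κ : ℝ) (K : ℝ) (hK : 0 < K)
    (hA0 : A.Nonempty)
    (h : (#A : ℝ) * #V ≤ K * ∑ c ∈ A, (#{w ∈ V | c + κ * w ∈ A} : ℝ)) :
    (#V : ℝ) ^ 2 ≤ 2 * K ^ 2 * #{p ∈ V ×ˢ V |
      (#A : ℝ) ≤ 2 * K ^ 2 * #{c ∈ A | c + κ * (p.1 - p.2) ∈ A}} := by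
  have hn : (0 : ℝ) < #A := by exact_mod_cast hA0.card_pos
  set f : ℝ × ℝ → ℕ := fun p => #{c ∈ A | c + κ * p.1 ∈ A ∧ c + κ * p.2 ∈ A} with hf
  have h1 : ∑ c ∈ A, #{w ∈ V | c + κ * w ∈ A} ^ 2 = ∑ p ∈ V ×ˢ V, f p := by
    rw [hf, sum_card_filter_eq_card_filter_product (V ×ˢ V) A
      (fun p c => c + κ * p.1 ∈ A ∧ c + κ * p.2 ∈ A)]
    have : ∀ c, #{w ∈ V | c + κ * w ∈ A} ^ 2 =
        #{p ∈ V ×ˢ V | c + κ * p.1 ∈ A ∧ c + κ * p.2 ∈ A} := by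
      intro c
      rw [sq, ← card_product]
      congr 1
      ext p
      simp only [mem_filter, mem_product]
      tauto
    simp only [this]
    simp only [card_filter, sum_product_right]
  have h2 : (∑ c ∈ A, (#{w ∈ V | c + κ * w ∈ A} : ℝ)) ^ 2 ≤
      #A * ∑ c ∈ A, (#{w ∈ V | c + κ * w ∈ A} : ℝ) ^ 2 := sq_sum_le_card_mul_sum_sq
  have h1' : ∑ c ∈ A, (#{w ∈ V | c + κ * w ∈ A} : ℝ) ^ 2 = ∑ p ∈ V ×ˢ V, (f p : ℝ) := by
    exact_mod_cast h1
  rw [h1'] at h2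
  have h3 : 2 * (#A / (2 * K ^ 2)) * (#(V ×ˢ V) : ℝ) ≤ ∑ p ∈ V ×ˢ V, (f p : ℝ) := by
    have h4 : ((#A : ℝ) * #V) ^ 2 ≤ K ^ 2 * (#A * ∑ p ∈ V ×ˢ V, (f p : ℝ)) := by
      calc ((#A : ℝ) * #V) ^ 2 ≤ (K * ∑ c ∈ A, (#{w ∈ V | c + κ * w ∈ A} : ℝ)) ^ 2 := by gcongr
        _ = K ^ 2 * (∑ c ∈ A, (#{w ∈ V | c + κ * w ∈ A} : ℝ)) ^ 2 := by ring
        _ ≤ _ := by gcongr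
    rw [card_product]
    push_cast
    have : 2 * ((#A : ℝ) / (2 * K ^ 2)) * (#V * #V) = ((#A : ℝ) * #V) ^ 2 / (K ^ 2 * #A) := by
      field_simp
    rw [this, div_le_iff₀ (by positivity)]
    linarith
  have h5 := mul_card_le_mul_card_popular (V ×ˢ V) f (#A) (#A / (2 * K ^ 2))
    (fun p _ => by exact_mod_cast card_filter_le _ _) (by positivity) h3
  have h6 : #{p ∈ V ×ˢ V | (#A : ℝ) / (2 * K ^ 2) ≤ f p} ≤ #{p ∈ V ×ˢ V |
      (#A : ℝ) ≤ 2 * K ^ 2 * #{c ∈ A | c + κ * (p.1 - p.2) ∈ A}} := by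
    refine card_le_card fun p hp => ?_
    obtain ⟨hp, hfp⟩ := mem_filter.mp hp
    refine mem_filter.mpr ⟨hp, ?_⟩
    rw [div_le_iff₀' (by positivity)] at hfp
    refine hfp.trans (mul_le_mul_of_nonneg_left ?_ (by positivity))
    have : f p ≤ #{c ∈ A | c + κ * (p.1 - p.2) ∈ A} := by
      refine card_le_card_of_injOn (fun c => c + κ * p.2) ?_ ?_
      · intro c hc
        simp only [coe_filter, Set.mem_ofPred_eq] at hc ⊢
        refine ⟨hc.2.2, ?_⟩
        have : c + κ * p.2 + κ * (p.1 - p.2) = c + κ * p.1 := by ring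
        rw [this]
        exact hc.2.1
      · intro c _ c' _ h
        exact add_right_cancel h
    exact_mod_cast this
  have h6' : (#{p ∈ V ×ˢ V | (#A : ℝ) / (2 * K ^ 2) ≤ f p} : ℝ) ≤ #{p ∈ V ×ˢ V |
      (#A : ℝ) ≤ 2 * K ^ 2 * #{c ∈ A | c + κ * (p.1 - p.2) ∈ A}} := by exact_mod_cast h6
  rw [card_product, Nat.cast_mul, div_mul_eq_mul_div, div_le_iff₀ (by positivity)] at h5
  have h7 : (#A : ℝ) * (#V) ^ 2 ≤ #A * (2 * K ^ 2 * #{p ∈ V ×ˢ V |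
      (#A : ℝ) ≤ 2 * K ^ 2 * #{c ∈ A | c + κ * (p.1 - p.2) ∈ A}}) := by
    calc (#A : ℝ) * (#V) ^ 2 = #A * (#V * #V) := by ring
      _ ≤ _ := h5
      _ = #A * (2 * K ^ 2 * #{p ∈ V ×ˢ V | (#A : ℝ) / (2 * K ^ 2) ≤ f p}) := by ring
      _ ≤ _ := by gcongr
  exact le_of_mul_le_mul_left h7 hn

/-- If the product set of `B` and `W` is small, most ratios of `W` are popular ratios of `B`. -/
lemma many_popular_ratios (B W : Finset ℝ) (hW0 : ∀ w ∈ W, 0 < w) (T n : ℝ)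
    (hB : (#B : ℝ) ≤ n) (hT : 0 < T) (hBW : (#(image₂ (· * ·) B W) : ℝ) ≤ T) :
    (#B : ℝ) ^ 2 * #W ^ 2 ≤ 2 * T * n * #{p ∈ W ×ˢ W |
      (#B : ℝ) ^ 2 ≤ 2 * T * #{c ∈ B | p.1 / p.2 * c ∈ B}} := by
  have h1 := sq_card_le_card_image_mul_energy (B ×ˢ W) (fun q => q.1 * q.2)
  set Q := {q ∈ (B ×ˢ W) ×ˢ (B ×ˢ W) | q.1.1 * q.1.2 = q.2.1 * q.2.2} with hQ
  have h2 : #Q ≤ ∑ p ∈ W ×ˢ W, #{c ∈ B | p.1 / p.2 * c ∈ B} := by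
    rw [sum_card_filter_eq_card_filter_product (W ×ˢ W) B (fun p c => p.1 / p.2 * c ∈ B)]
    refine card_le_card_of_injOn (fun q => ((q.1.2, q.2.2), q.1.1)) ?_ ?_
    · rintro ⟨⟨b, w⟩, ⟨b', w'⟩⟩ hq
      simp only [hQ, coe_filter, mem_product, Set.mem_ofPred_eq] at hq ⊢
      obtain ⟨⟨⟨hb, hw⟩, hb', hw'⟩, h⟩ := hq
      refine ⟨⟨⟨hw, hw'⟩, hb⟩, ?_⟩
      have := (hW0 w' hw').ne'
      have : w / w' * b = b' := by
        field_simp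
        linarith
      rwa [this]
    · rintro ⟨⟨b, w⟩, ⟨b', w'⟩⟩ hq ⟨⟨c, v⟩, ⟨c', v'⟩⟩ hq' h
      simp only [hQ, coe_filter, mem_product, Set.mem_ofPred_eq] at hq hq'
      simp only [Prod.mk.injEq] at h
      obtain ⟨⟨rfl, rfl⟩, rfl⟩ := h
      have := mul_right_cancel₀ (hW0 w' hq.1.2.2).ne' (hq.2.symm.trans hq'.2)
      rw [this]
  have h3 : ((B ×ˢ W).image (fun q => q.1 * q.2)) = image₂ (· * ·) B W := rfl
  rw [h3, card_product] at h1
  have h1' : ((#B : ℝ) * #W) ^ 2 ≤ #(image₂ (· * ·) B W) * #Q := by exact_mod_cast h1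
  have h2' : (#Q : ℝ) ≤ ∑ p ∈ W ×ˢ W, (#{c ∈ B | p.1 / p.2 * c ∈ B} : ℝ) := by
    exact_mod_cast h2
  have h4 : 2 * ((#B : ℝ) ^ 2 / (2 * T)) * (#(W ×ˢ W) : ℝ) ≤
      ∑ p ∈ W ×ˢ W, (#{c ∈ B | p.1 / p.2 * c ∈ B} : ℝ) := by
    rw [card_product]
    push_cast
    have : 2 * ((#B : ℝ) ^ 2 / (2 * T)) * (#W * #W) = ((#B : ℝ) * #W) ^ 2 / T := by
      field_simp
    rw [this, div_le_iff₀ hT]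
    refine h1'.trans ?_
    rw [mul_comm (∑ p ∈ W ×ˢ W, (#{c ∈ B | p.1 / p.2 * c ∈ B} : ℝ))]
    exact mul_le_mul hBW h2' (Nat.cast_nonneg _) hT.le
  have h5 := mul_card_le_mul_card_popular (W ×ˢ W) (fun p => #{c ∈ B | p.1 / p.2 * c ∈ B})
    n ((#B : ℝ) ^ 2 / (2 * T))
    (fun p _ => le_trans (by exact_mod_cast card_filter_le _ _) hB) (by positivity) h4
  have h6 : ∀ p : ℝ × ℝ, (#B : ℝ) ^ 2 / (2 * T) ≤ (#{c ∈ B | p.1 / p.2 * c ∈ B} : ℝ) ↔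
      (#B : ℝ) ^ 2 ≤ 2 * T * #{c ∈ B | p.1 / p.2 * c ∈ B} :=
    fun p => div_le_iff₀' (by positivity)
  simp only [h6] at h5
  rw [card_product, Nat.cast_mul, div_mul_eq_mul_div, div_le_iff₀ (by positivity)] at h5
  linarith

lemma pow_le_of_incidence_inequality {K τ n p e : ℝ} (hK : 1000 ≤ K) (hτ : 0 < τ)
    (hp : τ ^ 2 * p ≤ K ^ 100 * n ^ 2) (he : τ ^ 2 ≤ 128 * K ^ 22 * e)
    (hinc : e * (τ / (4 * K ^ 6)) ≤
      3 * (τ / (6 * K ^ 30)) * τ ^ 2 + 8 * p ^ 2 / (τ / (6 * K ^ 30)) ^ 2) (hp0 : 0 ≤ p) :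
    τ ^ 9 ≤ K ^ 291 * n ^ 4 := by
  have hK0 : 0 < K := by linarith
  have h1 : τ ^ 3 / K ^ 30 ≤ e * (τ / (4 * K ^ 6)) := by
    rw [div_le_iff₀ (by positivity)]
    have h512 : 512 ≤ K ^ 2 := by nlinarith
    have he0 : 0 ≤ e := by
      by_contra! h
      have : 128 * K ^ 22 * e < 0 := mul_neg_of_pos_of_neg (by positivity) h
      nlinarith [sq_nonneg τ]
    calc τ ^ 3 = τ * τ ^ 2 := by ring
      _ ≤ τ * (128 * K ^ 22 * e) := by gcongr
      _ = 512 * (τ * K ^ 22 * e / 4) := by ring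
      _ ≤ K ^ 2 * (τ * K ^ 22 * e / 4) := by gcongr
      _ = _ := by field_simp
  have h2 : 3 * (τ / (6 * K ^ 30)) * τ ^ 2 = τ ^ 3 / K ^ 30 / 2 := by field_simp; norm_num
  have h3 : 8 * p ^ 2 / (τ / (6 * K ^ 30)) ^ 2 = 288 * K ^ 60 * p ^ 2 / τ ^ 2 := by
    field_simp; ring
  rw [h2, h3] at hinc
  have h4 : τ ^ 3 / K ^ 30 ≤ 576 * K ^ 60 * p ^ 2 / τ ^ 2 := by
    have : 576 * K ^ 60 * p ^ 2 / τ ^ 2 = 2 * (288 * K ^ 60 * p ^ 2 / τ ^ 2) := by ring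
    linarith
  rw [div_le_div_iff₀ (by positivity) (by positivity)] at h4
  calc τ ^ 9 = τ ^ 4 * (τ ^ 3 * τ ^ 2) := by ring
    _ ≤ τ ^ 4 * (576 * K ^ 60 * p ^ 2 * K ^ 30) := by gcongr
    _ = 576 * K ^ 90 * (τ ^ 2 * p) ^ 2 := by ring
    _ ≤ K * K ^ 90 * (K ^ 100 * n ^ 2) ^ 2 := by
      gcongr
      linarith
    _ = _ := by ring

lemma card_pow_le_of_almost_periods (A V : Finset ℝ) (hA : ∀ a ∈ A, 0 < a) (hVA : V ⊆ A)
    (K : ℝ) (hK : 1000 ≤ K) (hA0 : A.Nonempty)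
    (hAV : (#(image₂ (· * ·) A V) : ℝ) ≤ K ^ 4 * #A) (κ : ℝ) (hκ : κ ≠ 0)
    (hdeg : (#A : ℝ) * #V ≤ K ^ 3 * ∑ c ∈ A, (#{w ∈ V | c + κ * w ∈ A} : ℝ))
    (hV : 6 * K ^ 30 ≤ #V) :
    (#V : ℝ) ^ 9 ≤ K ^ 291 * #A ^ 4 := by
  classical
  have hn : (0 : ℝ) < #A := by exact_mod_cast hA0.card_pos
  have hK0 : 0 < K := by linarith
  have hK1 : 1 ≤ K := by linarith
  have hτ : (0 : ℝ) < #V := lt_of_lt_of_le (by positivity) hV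
  have hVpos : ∀ v ∈ V, 0 < v := fun v hv => hA v (hVA hv)
  set n : ℝ := ((#A : ℕ) : ℝ) with hndef
  set τ : ℝ := ((#V : ℕ) : ℝ) with hτdef
  -- popular differences
  set D := {d ∈ image₂ (fun a b => a - b) A A | n ≤ 2 * K ^ 6 * #{c ∈ A | c + d ∈ A}} with hDdef
  have hDmem : ∀ d, n ≤ 2 * K ^ 6 * #{c ∈ A | c + d ∈ A} → d ∈ D := by
    intro d hd
    refine mem_filter.mpr ⟨?_, hd⟩
    have hne : {c ∈ A | c + d ∈ A}.Nonempty := by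
      rw [nonempty_iff_ne_empty]
      intro h
      rw [h] at hd
      simp only [card_empty, CharP.cast_eq_zero, mul_zero] at hd
      linarith
    obtain ⟨c, hc⟩ := hne
    obtain ⟨hc, hcd⟩ := mem_filter.mp hc
    exact mem_image₂.mpr ⟨c + d, hcd, c, hc, by ring⟩
  have hDbound : τ * #D ≤ K ^ 32 * n := by
    have := card_popular_differences_le A V D hA hVA (2 * K ^ 6) (by
        have : 1 ≤ K ^ 6 := one_le_pow₀ hK1
        linarith) hA0 (hAV.trans (by
        have : K ^ 4 ≤ K ^ 6 := pow_le_pow_right₀ hK1 (by norm_num)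
        gcongr
        nlinarith [pow_pos hK0 6])) (fun d hd => (mem_filter.mp hd).2)
    refine this.trans ?_
    have : 576 * (2 * K ^ 6) ^ 5 = 18432 * K ^ 30 := by ring
    rw [this]
    have h2 : K ^ 32 = K ^ 2 * K ^ 30 := by ring
    rw [h2]
    gcongr
    nlinarith
  have hdiff := many_popular_differences A V κ (K ^ 3) (by positivity) hA0 hdeg
  have e6 : (K ^ 3) ^ 2 = K ^ 6 := by ring
  rw [e6, ← hτdef] at hdiff
  -- elements of `V` with many popular differences
  set V' := {c ∈ V | τ / (4 * K ^ 6) ≤ #{b ∈ V | κ * (c - b) ∈ D}} with hV'def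
  have hV'card : τ ≤ 4 * K ^ 6 * #V' := by
    have h1 : #{p ∈ V ×ˢ V | n ≤ 2 * K ^ 6 * #{c ∈ A | c + κ * (p.1 - p.2) ∈ A}} ≤
        ∑ c ∈ V, #{b ∈ V | κ * (c - b) ∈ D} := by
      rw [sum_card_filter_eq_card_filter_product V V (fun c b => κ * (c - b) ∈ D)]
      refine card_le_card fun p hp => ?_
      obtain ⟨hp, h⟩ := mem_filter.mp hp
      exact mem_filter.mpr ⟨hp, hDmem _ h⟩
    have h1' : (#{p ∈ V ×ˢ V | n ≤ 2 * K ^ 6 * #{c ∈ A | c + κ * (p.1 - p.2) ∈ A}} : ℝ) ≤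
        ∑ c ∈ V, (#{b ∈ V | κ * (c - b) ∈ D} : ℝ) := by exact_mod_cast h1
    have h2 := mul_card_le_mul_card_popular V (fun c => #{b ∈ V | κ * (c - b) ∈ D}) τ
      (τ / (4 * K ^ 6)) (fun c _ => by
        rw [hτdef]
        exact_mod_cast card_filter_le _ _) (by positivity) (by
        refine le_trans ?_ h1'
        rw [← hτdef]
        have : 2 * (τ / (4 * K ^ 6)) * τ = τ ^ 2 / (2 * K ^ 6) := by field_simp; ring
        rw [this, div_le_iff₀ (by positivity)]
        linarith)
    rw [← hV'def, ← hτdef] at h2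
    have h3 := le_of_mul_le_mul_right (h2.trans (mul_comm _ _).le) hτ
    rwa [div_le_iff₀' (by positivity)] at h3
  -- elements of `A` with many translates in `A`
  set B := {c ∈ A | n * τ / (2 * K ^ 3 * n) ≤ #{w ∈ V | c + κ * w ∈ A}} with hBdef
  have hBA : B ⊆ A := filter_subset _ _
  have hBn : (#B : ℝ) ≤ n := by
    rw [hndef]
    exact_mod_cast card_le_card hBA
  have hBcard : n ≤ 2 * K ^ 3 * #B := by
    have h2 := mul_card_le_mul_card_popular A (fun c => #{w ∈ V | c + κ * w ∈ A}) τ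
      (n * τ / (2 * K ^ 3 * n)) (fun c _ => by
        rw [hτdef]
        exact_mod_cast card_filter_le _ _) (by positivity) (by
        rw [← hndef]
        have : 2 * (n * τ / (2 * K ^ 3 * n)) * n = n * τ / K ^ 3 := by field_simp
        rw [this, div_le_iff₀ (by positivity)]
        linarith)
    rw [← hBdef, ← hndef] at h2
    have h4 : n * τ / (2 * K ^ 3 * n) * n = τ * (n / (2 * K ^ 3)) := by field_simp
    rw [h4] at h2
    have h3 := le_of_mul_le_mul_left h2 hτ
    rwa [div_le_iff₀' (by positivity)] at h3
  -- popular ratios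
  have hratio := many_popular_ratios B V' (fun w hw => hVpos w (mem_filter.mp hw).1)
    (K ^ 4 * n) n hBn (by positivity) (by
      refine le_trans ?_ hAV
      exact_mod_cast card_le_card (image₂_subset hBA (filter_subset _ _)))
  set E := {p ∈ V' ×ˢ V' |
      (#B : ℝ) ^ 2 ≤ 2 * (K ^ 4 * n) * #{c ∈ B | p.1 / p.2 * c ∈ B}} with hEdef
  set P := E.image (fun p => p.1 / p.2) with hPdef
  have hBsq : n ^ 2 ≤ 4 * K ^ 6 * (#B : ℝ) ^ 2 := by
    calc n ^ 2 ≤ (2 * K ^ 3 * #B) ^ 2 := by gcongr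
      _ = _ := by ring
  have hPbound : #P * τ ≤ K ^ 68 * n := by
    have := card_popular_ratios_le A B V P κ hκ hA hBA hA0 (by
        intro p hp
        obtain ⟨e, he, rfl⟩ := mem_image.mp hp
        have he' := mem_product.mp (mem_filter.mp he).1
        exact (div_pos (hVpos _ (mem_filter.mp he'.1).1) (hVpos _ (mem_filter.mp he'.2).1)).ne')
      (n * τ / (2 * K ^ 3 * n)) (16 * K ^ 13) (by
        have : 1 ≤ K ^ 13 := one_le_pow₀ hK1
        linarith) (fun c hc => (mem_filter.mp hc).2) (by
        intro p hp
        obtain ⟨e, he, rfl⟩ := mem_image.mp hp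
        have he' := (mem_filter.mp he).2
        set r : ℝ := ((#{c ∈ B | e.1 / e.2 * c ∈ B} : ℕ) : ℝ)
        have h1 : n ^ 2 ≤ n * (8 * K ^ 10 * r) := by
          calc n ^ 2 ≤ 4 * K ^ 6 * (#B : ℝ) ^ 2 := hBsq
            _ ≤ 4 * K ^ 6 * (2 * (K ^ 4 * n) * r) := by gcongr
            _ = _ := by ring
        rw [sq] at h1
        have h2 := le_of_mul_le_mul_left h1 hn
        rw [← hndef, ← hτdef]
        calc τ * n ≤ τ * (8 * K ^ 10 * r) := by gcongr
          _ = 16 * K ^ 13 * (n * τ / (2 * K ^ 3 * n) * r) := by field_simp; ring)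
    refine this.trans ?_
    have : 576 * (16 * K ^ 13) ^ 5 = 603979776 * K ^ 65 := by ring
    rw [this]
    have h2 : K ^ 68 = K ^ 3 * K ^ 65 := by ring
    rw [h2]
    gcongr
    have : (1000 : ℝ) ^ 3 ≤ K ^ 3 := by gcongr
    linarith
  have hEcard : τ ^ 2 ≤ 128 * K ^ 22 * #E := by
    have h1 : n ^ 2 * (#V' : ℝ) ^ 2 ≤ n ^ 2 * (8 * K ^ 10 * #E) := by
      calc n ^ 2 * (#V' : ℝ) ^ 2 ≤ 4 * K ^ 6 * (#B : ℝ) ^ 2 * (#V' : ℝ) ^ 2 := by gcongr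
        _ = 4 * K ^ 6 * ((#B : ℝ) ^ 2 * (#V' : ℝ) ^ 2) := by ring
        _ ≤ 4 * K ^ 6 * (2 * (K ^ 4 * n) * n * #E) := by gcongr
        _ = _ := by ring
    have h2 := le_of_mul_le_mul_left h1 (by positivity)
    calc τ ^ 2 ≤ (4 * K ^ 6 * #V') ^ 2 := by gcongr
      _ = 16 * K ^ 12 * (#V' : ℝ) ^ 2 := by ring
      _ ≤ 16 * K ^ 12 * (8 * K ^ 10 * #E) := by gcongr
      _ = _ := by ring
  have hV'V : V' ⊆ V := filter_subset _ _
  have hx : 1 ≤ τ / (6 * K ^ 30) := by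
    rw [le_div_iff₀ (by positivity)]
    linarith
  have hinc := elekes_incidences V D P κ hκ hVpos E
    ((filter_subset _ _).trans (product_subset_product hV'V hV'V))
    (fun e he => mem_image_of_mem _ he) (τ / (4 * K ^ 6))
    (fun e he => (mem_filter.mp (mem_product.mp (mem_filter.mp he).1).1).2)
    (τ / (6 * K ^ 30)) hx
  rw [← hτdef] at hinc
  set p : ℝ := #D * #P with hpdef
  have hpbound : τ ^ 2 * p ≤ K ^ 100 * n ^ 2 := by
    calc τ ^ 2 * p = (τ * #D) * (#P * τ) := by ring
      _ ≤ (K ^ 32 * n) * (K ^ 68 * n) :=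
        mul_le_mul hDbound hPbound (mul_nonneg (Nat.cast_nonneg _) hτ.le) (by positivity)
      _ = _ := by ring
  exact pow_le_of_incidence_inequality hK hτ hpbound hEcard hinc
    (mul_nonneg (Nat.cast_nonneg _) (Nat.cast_nonneg _))

lemma exists_lower_part {ι : Type*} [LinearOrder ι] (s : Finset ι) (k : ℕ) (hk : k ≤ #s) :
    ∃ t ⊆ s, #t = k ∧ ∀ a ∈ t, ∀ b ∈ s \ t, a < b := by
  induction k with
  | zero => exact ⟨∅, by simp⟩
  | succ k ih =>
    obtain ⟨t, hts, htk, hlt⟩ := ih (by omega)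
    have hne : (s \ t).Nonempty := by
      rw [← card_pos, card_sdiff_of_subset hts]; omega
    have hm := (s \ t).min'_mem hne
    set m := (s \ t).min' hne with hmdef
    have hm' := mem_sdiff.1 hm
    refine ⟨insert m t, ?_, ?_, ?_⟩
    · exact insert_subset hm'.1 hts
    · rw [card_insert_of_notMem hm'.2, htk]
    · intro a ha b hb
      simp only [mem_sdiff, mem_insert, not_or] at hb
      have hb' : b ∈ s \ t := mem_sdiff.2 ⟨hb.1, hb.2.2⟩
      rcases mem_insert.1 ha with rfl | ha
      · exact lt_of_le_of_ne (min'_le _ _ hb') (Ne.symm hb.2.1)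
      · exact hlt a ha b hb'

lemma exists_points_between_slopes (P : Finset (ℝ × ℝ)) (M X q : ℕ) (Λ : Finset ℝ)
    (hq : 2 * M * q ≤ #Λ)
    (h : ∀ T₁ ⊆ Λ, ∀ T₂ ⊆ Λ, #T₁ = M → #T₂ = M → (∀ a ∈ T₁, ∀ b ∈ T₂, a < b) →
      ∃ S ⊆ P, X ≤ #S ∧
        ∀ z ∈ S, 0 < z.1 ∧ (∃ a ∈ T₁, a * z.1 < z.2) ∧ ∃ b ∈ T₂, z.2 < b * z.1) :
    ∃ S ⊆ P, q * X ≤ #S ∧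
      ∀ z ∈ S, 0 < z.1 ∧ (∃ a ∈ Λ, a * z.1 < z.2) ∧ ∃ b ∈ Λ, z.2 < b * z.1 := by
  induction q generalizing Λ with
  | zero => exact ⟨∅, by simp⟩
  | succ q ih =>
    have hq' : 2 * M * q + 2 * M ≤ #Λ := by linarith [mul_add (2 * M) q 1]
    obtain ⟨T, hT, hTc, hTlt⟩ := exists_lower_part Λ (2 * M) (by omega)
    obtain ⟨T₁, hT₁, hT₁c, hT₁lt⟩ := exists_lower_part T M (by omega)
    have hT₂c : #(T \ T₁) = M := by rw [card_sdiff_of_subset hT₁]; omega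
    obtain ⟨S₀, hS₀, hS₀c, hS₀z⟩ := h T₁ (hT₁.trans hT) (T \ T₁) (sdiff_subset.trans hT)
      hT₁c hT₂c hT₁lt
    obtain ⟨S, hS, hSc, hSz⟩ := ih (Λ \ T) (by rw [card_sdiff_of_subset hT]; omega)
      (fun U₁ hU₁ U₂ hU₂ ↦ h U₁ (hU₁.trans sdiff_subset) U₂ (hU₂.trans sdiff_subset))
    refine ⟨S₀ ∪ S, union_subset hS₀ hS, ?_, ?_⟩
    · rw [card_union_of_disjoint]
      · linarith [add_mul q 1 X]
      · rw [disjoint_left]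
        intro z hz hz'
        obtain ⟨h0, -, b, hb, hzb⟩ := hS₀z z hz
        obtain ⟨-, ⟨a, ha, haz⟩, -⟩ := hSz z hz'
        have := hTlt b (sdiff_subset hb) a ha
        nlinarith
    · intro z hz
      rcases mem_union.1 hz with hz | hz
      · obtain ⟨h0, ⟨a, ha, haz⟩, b, hb, hzb⟩ := hS₀z z hz
        exact ⟨h0, ⟨a, hT (hT₁ ha), haz⟩, b, hT (sdiff_subset hb), hzb⟩
      · obtain ⟨h0, ⟨a, ha, haz⟩, b, hb, hzb⟩ := hSz z hz
        exact ⟨h0, ⟨a, sdiff_subset ha, haz⟩, b, sdiff_subset hb, hzb⟩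

lemma mul_le_card_of_points_between_slopes (P : Finset (ℝ × ℝ)) (M X : ℕ) (Λ : Finset ℝ)
    (hM : 1 ≤ M) (hΛ : 2 * M ≤ #Λ)
    (h : ∀ T₁ ⊆ Λ, ∀ T₂ ⊆ Λ, #T₁ = M → #T₂ = M → (∀ a ∈ T₁, ∀ b ∈ T₂, a < b) →
      ∃ S ⊆ P, X ≤ #S ∧
        ∀ z ∈ S, 0 < z.1 ∧ (∃ a ∈ T₁, a * z.1 < z.2) ∧ ∃ b ∈ T₂, z.2 < b * z.1) :
    #Λ * X ≤ 4 * M * #P := by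
  obtain ⟨S, hS, hSc, -⟩ := exists_points_between_slopes P M X (#Λ / (2 * M)) Λ
    (Nat.mul_div_le _ _) h
  have h1 : #Λ ≤ 4 * M * (#Λ / (2 * M)) := by
    have := Nat.div_add_mod (#Λ) (2 * M)
    have h2 := Nat.mod_lt (#Λ) (show 0 < 2 * M by omega)
    have h3 : 1 ≤ #Λ / (2 * M) := (Nat.one_le_div_iff (by omega)).2 hΛ
    nlinarith
  calc #Λ * X ≤ 4 * M * (#Λ / (2 * M)) * X := Nat.mul_le_mul_right _ h1
    _ = 4 * M * (#Λ / (2 * M) * X) := by ring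
    _ ≤ 4 * M * #P := Nat.mul_le_mul_left _ (hSc.trans (card_le_card hS))

/-- Dyadic pigeonholing of the ratios of a finite set of positive reals. -/
lemma exists_popular_slopes (A : Finset ℝ) (hA : ∀ a ∈ A, 0 < a) (hA0 : A.Nonempty) (K : ℕ)
    (hK : Nat.log 2 #A + 1 ≤ K) :
    ∃ (τ : ℕ) (Λ : Finset ℝ) (V : ℝ → Finset ℝ), 1 ≤ τ ∧ τ ≤ #A ∧
      (∀ l ∈ Λ, V l ⊆ A ∧ #(V l) = τ ∧ ∀ w ∈ V l, l * w ∈ A) ∧ #A ^ 2 ≤ 2 * K * τ * #Λ := by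
  set R := image₂ (fun b a ↦ b / a) A A with hR
  set d : ℝ → ℕ := fun l ↦ #{a ∈ A | l * a ∈ A} with hd
  have hd1 : ∀ l ∈ R, 1 ≤ d l := by
    intro l hl
    obtain ⟨b, hb, a, ha, rfl⟩ := mem_image₂.1 hl
    refine card_pos.2 ⟨a, mem_filter.2 ⟨ha, ?_⟩⟩
    rwa [div_mul_cancel₀ _ (hA a ha).ne']
  have hdA : ∀ l, d l ≤ #A := fun l ↦ card_filter_le _ _
  have hsum : #A ^ 2 ≤ ∑ l ∈ R, d l := by
    have h1 : #(A ×ˢ A) ≤ ∑ l ∈ R, #{p ∈ A ×ˢ A | p.1 / p.2 = l} := by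
      rw [← card_eq_sum_card_fiberwise]
      intro p hp
      simp only [coe_product, Set.mem_prod, mem_coe] at hp
      exact mem_coe.2 (mem_image₂_of_mem hp.1 hp.2)
    rw [card_product, ← sq] at h1
    refine h1.trans (sum_le_sum fun l _ ↦ ?_)
    refine card_le_card_of_injOn Prod.snd ?_ ?_
    · intro p hp
      simp only [coe_filter, mem_product, Set.mem_ofPred_eq] at hp ⊢
      refine ⟨hp.1.2, ?_⟩
      rw [← hp.2, div_mul_cancel₀ _ (hA _ hp.1.2).ne']
      exact hp.1.1
    · rintro ⟨p, a⟩ hp ⟨p', a'⟩ hp' h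
      simp only [coe_filter, mem_product, Set.mem_ofPred_eq] at hp hp' h
      subst h
      have := (hA _ hp.1.2).ne'
      have h2 := hp.2.trans hp'.2.symm
      rw [div_left_inj' this] at h2
      rw [h2]
  have hfib : ∑ l ∈ R, d l = ∑ j ∈ range K, ∑ l ∈ R with Nat.log 2 (d l) = j, d l := by
    refine (sum_fiberwise_of_maps_to (fun l hl ↦ ?_) _).symm
    rw [mem_range]
    exact lt_of_lt_of_le (Nat.lt_succ_of_le (Nat.log_mono_right (hdA l))) hK
  have hK0 : (range K).Nonempty := by rw [nonempty_range_iff]; omega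
  obtain ⟨j, hj, hjs⟩ : ∃ j ∈ range K, #A ^ 2 ≤ K * ∑ l ∈ R with Nat.log 2 (d l) = j, d l := by
    by_contra! hcon
    have := sum_lt_sum_of_nonempty hK0 hcon
    rw [← mul_sum, ← hfib, sum_const, card_range, smul_eq_mul] at this
    have := Nat.mul_le_mul_left K hsum
    omega
  have hA1 : 1 ≤ #A := hA0.card_pos
  have hΛ0 : (R.filter fun l ↦ Nat.log 2 (d l) = j).Nonempty := by
    rw [nonempty_iff_ne_empty]
    intro h
    rw [h] at hjs
    simp only [sum_empty, mul_zero] at hjs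
    have : 0 < #A ^ 2 := pow_pos (by omega) 2
    omega
  have hτ : ∀ l ∈ R.filter fun l ↦ Nat.log 2 (d l) = j, 2 ^ j ≤ d l ∧ d l ≤ 2 * 2 ^ j := by
    intro l hl
    obtain ⟨hlR, rfl⟩ := mem_filter.1 hl
    refine ⟨Nat.pow_log_le_self 2 (by have := hd1 l hlR; omega), ?_⟩
    have := (Nat.lt_pow_succ_log_self (b := 2) (by norm_num) (d l)).le
    rwa [pow_succ'] at this
  have hV : ∀ l, ∃ W : Finset ℝ, (l ∈ R.filter fun l ↦ Nat.log 2 (d l) = j) →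
      W ⊆ {a ∈ A | l * a ∈ A} ∧ #W = 2 ^ j := by
    intro l
    by_cases hl : l ∈ R.filter fun l ↦ Nat.log 2 (d l) = j
    · obtain ⟨W, hW⟩ := exists_subset_card_eq (hτ l hl).1
      exact ⟨W, fun _ ↦ hW⟩
    · exact ⟨∅, fun h ↦ absurd h hl⟩
  choose V hV using hV
  refine ⟨2 ^ j, R.filter fun l ↦ Nat.log 2 (d l) = j, V, Nat.one_le_two_pow, ?_, ?_, ?_⟩
  · obtain ⟨l, hl⟩ := hΛ0
    exact (hτ l hl).1.trans (hdA l)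
  · intro l hl
    obtain ⟨h1, h2⟩ := hV l hl
    exact ⟨h1.trans (filter_subset _ _), h2, fun w hw ↦ (mem_filter.1 (h1 hw)).2⟩
  · refine hjs.trans ?_
    have h3 := sum_le_card_nsmul (R.filter fun l ↦ Nat.log 2 (d l) = j) d (2 * 2 ^ j)
      (fun l hl ↦ (hτ l hl).2)
    rw [smul_eq_mul] at h3
    calc _ ≤ K * (_ * (2 * 2 ^ j)) := Nat.mul_le_mul_left K h3
      _ = _ := by ring

lemma card_mul_le_of_large_products (A Q : Finset ℝ) (hA : ∀ a ∈ A, 0 < a)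
    (hQ : ∀ a ∈ A, ∀ b ∈ A, ∀ c ∈ A, a * b + c ∈ Q) (Λ : Finset ℝ) (V : ℝ → Finset ℝ) (τ Y : ℕ)
    (hV : ∀ l ∈ Λ, V l ⊆ A ∧ #(V l) = τ ∧ ∀ w ∈ V l, l * w ∈ A)
    (hY : ∀ l ∈ Λ, Y ≤ #(image₂ (· * ·) A (V l))) (hΛ : 2 ≤ #Λ) :
    #Λ * (Y * τ) ≤ 4 * #Q ^ 2 := by
  have key := mul_le_card_of_points_between_slopes (Q ×ˢ Q) 1 (Y * τ) Λ le_rfl (by omega) ?_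
  · rwa [card_product, mul_one, ← sq] at key
  intro T₁ hT₁ T₂ hT₂ h₁ h₂ hlt
  obtain ⟨l, rfl⟩ := card_eq_one.1 h₁
  obtain ⟨m, rfl⟩ := card_eq_one.1 h₂
  have hl : l ∈ Λ := hT₁ (mem_singleton_self l)
  have hm : m ∈ Λ := hT₂ (mem_singleton_self m)
  have hlm : l < m := hlt l (mem_singleton_self l) m (mem_singleton_self m)
  refine ⟨(image₂ (· * ·) A (V l) ×ˢ V m).image fun p ↦ (p.1 + p.2, l * p.1 + m * p.2), ?_, ?_, ?_⟩
  · intro z hz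
    obtain ⟨⟨u, w⟩, hp, rfl⟩ := mem_image.1 hz
    obtain ⟨hu, hw⟩ := mem_product.1 hp
    obtain ⟨c, hc, v, hv, rfl⟩ := mem_image₂.1 hu
    refine mem_product.2 ⟨hQ c hc v ((hV l hl).1 hv) w ((hV m hm).1 hw), ?_⟩
    have := hQ c hc _ ((hV l hl).2.2 v hv) _ ((hV m hm).2.2 w hw)
    rwa [mul_left_comm] at this
  · rw [card_image_of_injective, card_product, (hV m hm).2.1]
    · exact Nat.mul_le_mul_right _ (hY l hl)
    · rintro ⟨u, w⟩ ⟨u', w'⟩ h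
      simp only [Prod.mk.injEq] at h
      have h3 : (m - l) * (w - w') = 0 := by linear_combination h.2 - l * h.1
      have h4 : w = w' := by
        rcases mul_eq_zero.1 h3 with h3 | h3 <;> linarith
      simp only [Prod.mk.injEq]
      exact ⟨by linarith [h.1], h4⟩
  · intro z hz
    obtain ⟨⟨u, w⟩, hp, rfl⟩ := mem_image.1 hz
    obtain ⟨hu, hw⟩ := mem_product.1 hp
    obtain ⟨c, hc, v, hv, rfl⟩ := mem_image₂.1 hu
    have hu0 : 0 < c * v := mul_pos (hA c hc) (hA v ((hV l hl).1 hv))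
    have hw0 : 0 < w := hA w ((hV m hm).1 hw)
    refine ⟨add_pos hu0 hw0, ⟨l, mem_singleton_self l, ?_⟩, m, mem_singleton_self m, ?_⟩
    · dsimp only
      nlinarith
    · dsimp only
      nlinarith

/-- Quadruples `(l, m, c, w)` with `l ∈ T₁`, `m ∈ T₂`, `c ∈ A` and `w ∈ V m`. -/
noncomputable def slopeConfigs (A T₁ T₂ : Finset ℝ) (V : ℝ → Finset ℝ) :
    Finset (ℝ × ℝ × ℝ × ℝ) :=
  {q ∈ T₁ ×ˢ T₂ ×ˢ A ×ˢ A | q.2.2.2 ∈ V q.2.1}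

/-- The sum of a point on the line of slope `l` and a point on the line of slope `m`. -/
def slopeSum (v : ℝ → ℝ) (q : ℝ × ℝ × ℝ × ℝ) : ℝ × ℝ :=
  (v q.1 * q.2.2.1 + q.2.2.2, q.1 * (v q.1 * q.2.2.1) + q.2.1 * q.2.2.2)

lemma mem_slopeConfigs {A T₁ T₂ : Finset ℝ} {V : ℝ → Finset ℝ} {l m c w : ℝ} :
    (l, m, c, w) ∈ slopeConfigs A T₁ T₂ V ↔ l ∈ T₁ ∧ m ∈ T₂ ∧ c ∈ A ∧ w ∈ A ∧ w ∈ V m := by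
  simp [slopeConfigs, and_assoc]

lemma card_slopeConfigs (A T₁ T₂ : Finset ℝ) (V : ℝ → Finset ℝ) (τ : ℕ)
    (hV : ∀ m ∈ T₂, V m ⊆ A ∧ #(V m) = τ) :
    #(slopeConfigs A T₁ T₂ V) = #T₁ * #T₂ * #A * τ := by
  have h1 : slopeConfigs A T₁ T₂ V =
      (T₁ ×ˢ A ×ˢ T₂.sigma V).image fun p ↦ (p.1, p.2.2.1, p.2.1, p.2.2.2) := by
    ext ⟨l, m, c, w⟩
    rw [mem_slopeConfigs]
    simp only [mem_image, mem_product, mem_sigma, Prod.mk.injEq, Prod.exists, Sigma.exists]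
    constructor
    · rintro ⟨hl, hm, hc, hw, hwV⟩
      exact ⟨l, c, m, w, ⟨hl, hc, hm, hwV⟩, rfl, rfl, rfl, rfl⟩
    · rintro ⟨l', c', m', w', ⟨hl, hc, hm, hw⟩, rfl, rfl, rfl, rfl⟩
      exact ⟨hl, hm, hc, (hV _ hm).1 hw, hw⟩
  rw [h1, card_image_of_injective, card_product, card_product, card_sigma,
    sum_congr rfl fun m hm ↦ (hV m hm).2, sum_const, smul_eq_mul]
  · ring
  · rintro ⟨l, c, m, w⟩ ⟨l', c', m', w'⟩ h
    simp only [Prod.mk.injEq] at h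
    obtain ⟨rfl, rfl, rfl, rfl⟩ := h
    rfl

lemma exists_large_slopeSum_energy (A Q : Finset ℝ) (hA : ∀ a ∈ A, 0 < a)
    (hQ : ∀ a ∈ A, ∀ b ∈ A, ∀ c ∈ A, a * b + c ∈ Q) (Λ : Finset ℝ) (V : ℝ → Finset ℝ) (τ : ℕ)
    (hV : ∀ l ∈ Λ, V l ⊆ A ∧ #(V l) = τ ∧ ∀ w ∈ V l, l * w ∈ A)
    (v : ℝ → ℝ) (hv : ∀ l ∈ Λ, v l ∈ V l) (M X : ℕ) (hM : 1 ≤ M) (hΛ : 2 * M ≤ #Λ)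
    (hX : 4 * M * #Q ^ 2 < #Λ * X) :
    ∃ T₁ ⊆ Λ, ∃ T₂ ⊆ Λ, #T₁ = M ∧ #T₂ = M ∧ (∀ a ∈ T₁, ∀ b ∈ T₂, a < b) ∧
      (M * M * #A * τ) ^ 2 ≤ X * #{p ∈ slopeConfigs A T₁ T₂ V ×ˢ slopeConfigs A T₁ T₂ V |
        slopeSum v p.1 = slopeSum v p.2} := by
  by_contra! hcon
  have key := mul_le_card_of_points_between_slopes (Q ×ˢ Q) M X Λ hM hΛ ?_
  · rw [card_product, ← sq] at key
    omega
  intro T₁ hT₁ T₂ hT₂ h₁ h₂ hlt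
  refine ⟨(slopeConfigs A T₁ T₂ V).image (slopeSum v), ?_, ?_, ?_⟩
  · intro z hz
    obtain ⟨⟨l, m, c, w⟩, hp, rfl⟩ := mem_image.1 hz
    obtain ⟨hl, hm, hc, hw, hwV⟩ := mem_slopeConfigs.1 hp
    obtain ⟨hVl, -, hVl'⟩ := hV l (hT₁ hl)
    have hvl := hv l (hT₁ hl)
    refine mem_product.2 ⟨hQ _ (hVl hvl) c hc w hw, ?_⟩
    have := hQ _ (hVl' _ hvl) c hc _ ((hV m (hT₂ hm)).2.2 w hwV)
    rwa [mul_assoc] at this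
  · have h3 := hcon T₁ hT₁ T₂ hT₂ h₁ h₂ hlt
    have h4 := sq_card_le_card_image_mul_energy (slopeConfigs A T₁ T₂ V) (slopeSum v)
    rw [card_slopeConfigs A T₁ T₂ V τ fun m hm ↦ ⟨(hV m (hT₂ hm)).1, (hV m (hT₂ hm)).2.1⟩,
      h₁, h₂] at h4
    exact (Nat.lt_of_mul_lt_mul_right (h3.trans_le h4)).le
  · intro z hz
    obtain ⟨⟨l, m, c, w⟩, hp, rfl⟩ := mem_image.1 hz
    obtain ⟨hl, hm, hc, hw, hwV⟩ := mem_slopeConfigs.1 hp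
    have hlm := hlt l hl m hm
    have hu0 : 0 < v l * c := mul_pos (hA _ ((hV l (hT₁ hl)).1 (hv l (hT₁ hl)))) (hA c hc)
    have hw0 : 0 < w := hA w hw
    refine ⟨add_pos hu0 hw0, ⟨l, hl, ?_⟩, m, hm, ?_⟩ <;>
    · simp only [slopeSum]
      nlinarith

lemma card_slopeSum_energy_le (A T₁ T₂ : Finset ℝ) (V : ℝ → Finset ℝ) (v : ℝ → ℝ) (τ M : ℕ)
    (hT₁ : #T₁ = M) (hT₂ : #T₂ = M) (hlt : ∀ a ∈ T₁, ∀ b ∈ T₂, a < b)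
    (hV : ∀ m ∈ T₂, V m ⊆ A ∧ #(V m) = τ) (hv : ∀ l ∈ T₁, 0 < v l) (N : ℕ)
    (hN : ∀ m ∈ T₂, ∀ m' ∈ T₂, ∀ α β : ℝ, α ≠ 0 → β ≠ 0 →
      #{p ∈ V m ×ˢ V m' | α * p.1 + β * p.2 ∈ A} ≤ N) :
    #{p ∈ slopeConfigs A T₁ T₂ V ×ˢ slopeConfigs A T₁ T₂ V | slopeSum v p.1 = slopeSum v p.2} ≤
      M * M * #A * τ + N * (M * M * M * M) +
      #{p ∈ slopeConfigs A T₁ T₂ V ×ˢ slopeConfigs A T₁ T₂ V | slopeSum v p.1 = slopeSum v p.2 ∧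
        p.1.1 = p.2.1 ∧ p.1.2.1 ≠ p.2.2.1} := by
  have hdiag : #{p ∈ slopeConfigs A T₁ T₂ V ×ˢ slopeConfigs A T₁ T₂ V |
      slopeSum v p.1 = slopeSum v p.2 ∧ p.1.1 = p.2.1 ∧ p.1.2.1 = p.2.2.1} ≤ M * M * #A * τ := by
    have hΩ := card_slopeConfigs A T₁ T₂ V τ hV
    rw [hT₁, hT₂] at hΩ
    rw [← hΩ]
    refine card_le_card_of_injOn Prod.fst ?_ ?_
    · intro p hp
      exact mem_coe.2 (mem_product.1 (mem_filter.1 (mem_coe.1 hp)).1).1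
    · have hdet : ∀ p ∈ slopeConfigs A T₁ T₂ V, ∀ q ∈ slopeConfigs A T₁ T₂ V,
          slopeSum v p = slopeSum v q → p.1 = q.1 → p.2.1 = q.2.1 → p = q := by
        rintro ⟨l, m, c, w⟩ hp ⟨l', m', c', w'⟩ hq h hl hm
        obtain ⟨hl, hm, -⟩ := mem_slopeConfigs.1 hp
        dsimp only at *
        subst l' m'
        simp only [slopeSum, Prod.mk.injEq] at h
        have h1 : (m - l) * (w - w') = 0 := by linear_combination h.2 - l * h.1
        have hlm := hlt l hl m hm
        have h2 : w = w' := by rcases mul_eq_zero.1 h1 with h1 | h1 <;> linarith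
        have h3 : v l * c = v l * c' := by linarith [h.1]
        rw [mul_right_inj' (hv l hl).ne'] at h3
        rw [h2, h3]
      rintro ⟨p, q⟩ hp ⟨p', q'⟩ hp' h
      simp only [coe_filter, mem_product, Set.mem_ofPred_eq] at hp hp' h
      subst p'
      rw [hdet q hp.1.2 q' hp'.1.2 (hp.2.1.symm.trans hp'.2.1) (hp.2.2.1.symm.trans hp'.2.2.1)
        (hp.2.2.2.symm.trans hp'.2.2.2)]
  have hoff : #{p ∈ slopeConfigs A T₁ T₂ V ×ˢ slopeConfigs A T₁ T₂ V |
      slopeSum v p.1 = slopeSum v p.2 ∧ p.1.1 ≠ p.2.1} ≤ N * (M * M * M * M) := by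
    have hcard : #((T₁ ×ˢ T₁) ×ˢ T₂ ×ˢ T₂) = M * M * M * M := by
      simp only [card_product, hT₁, hT₂]; ring
    rw [← hcard]
    refine card_le_mul_card_image_of_maps_to
      (f := fun p ↦ ((p.1.1, p.2.1), (p.1.2.1, p.2.2.1))) ?_ N ?_
    · rintro ⟨⟨l, m, c, w⟩, l', m', c', w'⟩ hp
      obtain ⟨hp, hq⟩ := mem_product.1 (mem_filter.1 hp).1
      obtain ⟨hl, hm, -⟩ := mem_slopeConfigs.1 hp
      obtain ⟨hl', hm', -⟩ := mem_slopeConfigs.1 hq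
      simp only [mem_product]
      exact ⟨⟨hl, hl'⟩, hm, hm'⟩
    · rintro ⟨⟨l, l'⟩, m, m'⟩ hb
      simp only [mem_product] at hb
      obtain ⟨⟨hl, hl'⟩, hm, hm'⟩ := hb
      by_cases hll : l = l'
      · refine (card_eq_zero.2 ?_).trans_le (Nat.zero_le _)
        rw [filter_eq_empty_iff]
        rintro ⟨⟨l₁, m₁, c, w⟩, l₂, m₂, c', w'⟩ hp h
        simp only [Prod.mk.injEq] at h
        refine (mem_filter.1 hp).2.2 ?_
        simp only
        rw [h.1.1, h.1.2, hll]
      have hvl := (hv l hl).ne'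
      have hvl' := (hv l' hl').ne'
      have hll' : l - l' ≠ 0 := sub_ne_zero.2 hll
      have hα : -(m - l') / ((l - l') * v l) ≠ 0 :=
        div_ne_zero (by linarith [hlt l' hl' m hm] : -(m - l') < 0).ne (mul_ne_zero hll' hvl)
      have hβ : (m' - l') / ((l - l') * v l) ≠ 0 :=
        div_ne_zero (by linarith [hlt l' hl' m' hm'] : 0 < m' - l').ne' (mul_ne_zero hll' hvl)
      have hc : ∀ c w c' w' : ℝ, slopeSum v (l, m, c, w) = slopeSum v (l', m', c', w') →
          c = -(m - l') / ((l - l') * v l) * w + (m' - l') / ((l - l') * v l) * w' := by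
        intro c w c' w' h
        simp only [slopeSum, Prod.mk.injEq] at h
        field_simp
        linear_combination h.2 - l' * h.1
      refine le_trans ?_ (hN m hm m' hm' _ _ hα hβ)
      refine card_le_card_of_injOn (fun p ↦ (p.1.2.2.2, p.2.2.2.2)) ?_ ?_
      · rintro ⟨⟨l₁, m₁, c, w⟩, l₂, m₂, c', w'⟩ hp
        simp only [coe_filter, mem_filter, mem_product, Set.mem_ofPred_eq, Prod.mk.injEq] at hp
        obtain ⟨⟨⟨hp, hq⟩, hs, -⟩, ⟨rfl, rfl⟩, rfl, rfl⟩ := hp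
        obtain ⟨-, -, hcA, -, hw⟩ := mem_slopeConfigs.1 hp
        obtain ⟨-, -, -, -, hw'⟩ := mem_slopeConfigs.1 hq
        simp only [coe_filter, mem_product, Set.mem_ofPred_eq]
        refine ⟨⟨hw, hw'⟩, ?_⟩
        rwa [← hc c w c' w' hs]
      · rintro ⟨⟨l₁, m₁, c, w⟩, l₂, m₂, c', w'⟩ hp ⟨⟨l₃, m₃, c₃, w₃⟩, l₄, m₄, c₄, w₄⟩ hp' h
        simp only [coe_filter, mem_filter, mem_product, Set.mem_ofPred_eq, Prod.mk.injEq]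
          at hp hp' h
        obtain ⟨⟨-, hs, -⟩, ⟨rfl, rfl⟩, rfl, rfl⟩ := hp
        obtain ⟨⟨-, hs', -⟩, ⟨rfl, rfl⟩, rfl, rfl⟩ := hp'
        obtain ⟨rfl, rfl⟩ := h
        have h1 := (hc _ _ _ _ hs).trans (hc _ _ _ _ hs').symm
        subst h1
        simp only [slopeSum, Prod.mk.injEq] at hs hs'
        have h2 : v l₄ * c' = v l₄ * c₄ := by linarith [hs.1, hs'.1]
        rw [mul_right_inj' hvl'] at h2
        rw [h2]
  refine le_trans ?_ (Nat.add_le_add_right (Nat.add_le_add hdiag hoff) _)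
  refine le_trans (card_le_card ?_) ((card_union_le _ _).trans
    (Nat.add_le_add_right (card_union_le _ _) _))
  intro p hp
  obtain ⟨hp, hs⟩ := mem_filter.1 hp
  simp only [mem_union, mem_filter]
  tauto

lemma card_slopeSum_energy_same_slope_le (A T₁ T₂ : Finset ℝ) (V : ℝ → Finset ℝ) (v : ℝ → ℝ)
    (τ M : ℕ) (hA : ∀ a ∈ A, 0 < a) (hT₂ : #T₂ = M)
    (hV : ∀ m ∈ T₂, V m ⊆ A ∧ #(V m) = τ) (hv : ∀ l ∈ T₁, 0 < v l) :
    #{p ∈ slopeConfigs A T₁ T₂ V ×ˢ slopeConfigs A T₁ T₂ V | slopeSum v p.1 = slopeSum v p.2 ∧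
        p.1.1 = p.2.1 ∧ p.1.2.1 ≠ p.2.2.1} ≤ τ * τ * #A * (M * M) := by
  have hcard : #(T₂ ×ˢ T₂) = M * M := by rw [card_product, hT₂]
  rw [← hcard]
  refine card_le_mul_card_image_of_maps_to (f := fun p ↦ (p.1.2.1, p.2.2.1)) ?_ _ ?_
  · rintro ⟨⟨l, m, c, w⟩, l', m', c', w'⟩ hp
    obtain ⟨hp, hq⟩ := mem_product.1 (mem_filter.1 hp).1
    exact mem_product.2 ⟨(mem_slopeConfigs.1 hp).2.1, (mem_slopeConfigs.1 hq).2.1⟩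
  rintro ⟨m, m'⟩ hb
  obtain ⟨hm, hm'⟩ := mem_product.1 hb
  have hcard' : #((V m ×ˢ V m') ×ˢ A) = τ * τ * #A := by
    rw [card_product, card_product, (hV m hm).2, (hV m' hm').2]
  rw [← hcard']
  refine card_le_card_of_injOn (fun p ↦ ((p.1.2.2.2, p.2.2.2.2), p.1.2.2.1)) ?_ ?_
  · rintro ⟨⟨l₁, m₁, c, w⟩, l₂, m₂, c', w'⟩ hp
    simp only [coe_filter, mem_filter, mem_product, Set.mem_ofPred_eq, Prod.mk.injEq] at hp
    obtain ⟨⟨⟨hp, hq⟩, -⟩, rfl, rfl⟩ := hp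
    obtain ⟨-, -, hcA, -, hw⟩ := mem_slopeConfigs.1 hp
    obtain ⟨-, -, -, -, hw'⟩ := mem_slopeConfigs.1 hq
    simp only [coe_product, Set.mem_prod, mem_coe]
    exact ⟨⟨hw, hw'⟩, hcA⟩
  · rintro ⟨⟨l₁, m₁, c, w⟩, l₂, m₂, c', w'⟩ hp ⟨⟨l₃, m₃, c₃, w₃⟩, l₄, m₄, c₄, w₄⟩ hp' h
    simp only [coe_filter, mem_filter, mem_product, Set.mem_ofPred_eq, Prod.mk.injEq]
      at hp hp' h
    obtain ⟨⟨⟨hp, -⟩, hs, rfl, hne⟩, rfl, rfl⟩ := hp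
    obtain ⟨⟨⟨hp', -⟩, hs', rfl, -⟩, rfl, rfl⟩ := hp'
    obtain ⟨⟨rfl, rfl⟩, rfl⟩ := h
    obtain ⟨hl, -, -, hw, -⟩ := mem_slopeConfigs.1 hp
    simp only [slopeSum, Prod.mk.injEq] at hs hs'
    have h1 : (l₁ - l₃) * (w' - w) = 0 := by
      linear_combination hs.2 - hs'.2 - l₁ * hs.1 + l₃ * hs'.1
    have h2 : w' - w ≠ 0 := by
      intro h
      have h3 : (m₃ - m₄) * w = 0 := by
        linear_combination hs.2 - l₁ * hs.1 + (m₄ - l₁) * h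
      rcases mul_eq_zero.1 h3 with h3 | h3
      · exact hne (sub_eq_zero.1 h3)
      · exact (hA w hw).ne' h3
    have h4 : l₁ = l₃ := by
      rcases mul_eq_zero.1 h1 with h1 | h1
      · exact sub_eq_zero.1 h1
      · exact absurd h1 h2
    subst h4
    have h5 : v l₁ * c' = v l₁ * c₄ := by linarith [hs.1, hs'.1]
    rw [mul_right_inj' (hv l₁ hl).ne'] at h5
    rw [h5]

lemma card_slopeSum_energy_same_slope_le_of_shift (A T₁ T₂ : Finset ℝ) (V : ℝ → Finset ℝ)
    (v : ℝ → ℝ) (M N : ℕ) (hT₁ : #T₁ = M) (hT₂ : #T₂ = M)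
    (hlt : ∀ a ∈ T₁, ∀ b ∈ T₂, a < b) (hv : ∀ l ∈ T₁, 0 < v l)
    (hN : ∀ m ∈ T₂, ∀ κ : ℝ, κ ≠ 0 → #{p ∈ A ×ˢ V m | p.1 + κ * p.2 ∈ A} ≤ N) :
    #{p ∈ slopeConfigs A T₁ T₂ V ×ˢ slopeConfigs A T₁ T₂ V | slopeSum v p.1 = slopeSum v p.2 ∧
        p.1.1 = p.2.1 ∧ p.1.2.1 ≠ p.2.2.1} ≤ N * (M * M * M) := by
  have hcard : #(T₁ ×ˢ T₂ ×ˢ T₂) = M * M * M := by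
    simp only [card_product, hT₁, hT₂]; ring
  rw [← hcard]
  refine card_le_mul_card_image_of_maps_to (f := fun p ↦ (p.1.1, p.1.2.1, p.2.2.1)) ?_ _ ?_
  · rintro ⟨⟨l, m, c, w⟩, l', m', c', w'⟩ hp
    obtain ⟨hp, hq⟩ := mem_product.1 (mem_filter.1 hp).1
    obtain ⟨hl, hm, -⟩ := mem_slopeConfigs.1 hp
    exact mem_product.2 ⟨hl, mem_product.2 ⟨hm, (mem_slopeConfigs.1 hq).2.1⟩⟩
  rintro ⟨l, m, m'⟩ hb
  simp only [mem_product] at hb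
  obtain ⟨hl, hm, hm'⟩ := hb
  by_cases hmm : m = m'
  · refine (card_eq_zero.2 ?_).trans_le (Nat.zero_le _)
    rw [filter_eq_empty_iff]
    rintro ⟨⟨l₁, m₁, c, w⟩, l₂, m₂, c', w'⟩ hp h
    simp only [Prod.mk.injEq] at h
    refine (mem_filter.1 hp).2.2.2 ?_
    simp only
    rw [h.2.1, h.2.2, hmm]
  have hvl := (hv l hl).ne'
  have hlm' : m' - l ≠ 0 := (sub_pos.2 (hlt l hl m' hm')).ne'
  have hκ : (m - m') / ((m' - l) * v l) ≠ 0 :=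
    div_ne_zero (sub_ne_zero.2 hmm) (mul_ne_zero hlm' hvl)
  have hc : ∀ c w c' w' : ℝ, slopeSum v (l, m, c, w) = slopeSum v (l, m', c', w') →
      (m' - l) * w' = (m - l) * w ∧ c = c' + (m - m') / ((m' - l) * v l) * w := by
    intro c w c' w' h
    simp only [slopeSum, Prod.mk.injEq] at h
    have h1 : (m' - l) * w' = (m - l) * w := by linear_combination l * h.1 - h.2
    refine ⟨h1, ?_⟩
    field_simp
    linear_combination (m' - l) * h.1 + h1
  refine le_trans ?_ (hN m hm _ hκ)
  refine card_le_card_of_injOn (fun p ↦ (p.2.2.2.1, p.1.2.2.2)) ?_ ?_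
  · rintro ⟨⟨l₁, m₁, c, w⟩, l₂, m₂, c', w'⟩ hp
    simp only [coe_filter, mem_filter, mem_product, Set.mem_ofPred_eq, Prod.mk.injEq] at hp
    obtain ⟨⟨⟨hp, hq⟩, hs, rfl, -⟩, rfl, rfl, rfl⟩ := hp
    obtain ⟨-, -, hcA, -, hw⟩ := mem_slopeConfigs.1 hp
    obtain ⟨-, -, hcA', -, -⟩ := mem_slopeConfigs.1 hq
    simp only [coe_filter, mem_product, Set.mem_ofPred_eq]
    refine ⟨⟨hcA', hw⟩, ?_⟩
    rwa [← (hc c w c' w' hs).2]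
  · rintro ⟨⟨l₁, m₁, c, w⟩, l₂, m₂, c', w'⟩ hp ⟨⟨l₃, m₃, c₃, w₃⟩, l₄, m₄, c₄, w₄⟩ hp' h
    simp only [coe_filter, mem_filter, mem_product, Set.mem_ofPred_eq, Prod.mk.injEq]
      at hp hp' h
    obtain ⟨⟨-, hs, rfl, -⟩, rfl, rfl, rfl⟩ := hp
    obtain ⟨⟨-, hs', rfl, -⟩, rfl, rfl, rfl⟩ := hp'
    obtain ⟨rfl, rfl⟩ := h
    obtain ⟨h1, rfl⟩ := hc _ _ _ _ hs
    obtain ⟨h2, rfl⟩ := hc _ _ _ _ hs'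
    have h3 := h1.trans h2.symm
    rw [mul_right_inj' hlm'] at h3
    rw [h3]

lemma card_linear_pairs_mul_le (A V V' : Finset ℝ) (hA : ∀ a ∈ A, 0 < a) (hV : V ⊆ A)
    (hV' : V' ⊆ A) (α β : ℝ) (hα : α ≠ 0) (hβ : β ≠ 0) (x : ℝ) (hx : 1 ≤ x) :
    (#{p ∈ V ×ˢ V' | α * p.1 + β * p.2 ∈ A} : ℝ) * #V ≤
      3 * x * (#(image₂ (· * ·) A V) * #V) + 8 * ((#V : ℝ) * #A) ^ 2 / x ^ 2 := by
  set L := (image₂ (· * ·) A V ×ˢ V).image fun p ↦ (β * p.1, α * p.2) with hLdef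
  have hL : ∀ l ∈ L, l.1 ≠ 0 := by
    intro l hl
    obtain ⟨⟨p, w⟩, hp, rfl⟩ := mem_image.1 hl
    obtain ⟨a, ha, v, hv, rfl⟩ := mem_image₂.1 (mem_product.1 hp).1
    exact mul_ne_zero hβ (mul_pos (hA a ha) (hA v (hV hv))).ne'
  have hLc : #L = #(image₂ (· * ·) A V) * #V := by
    rw [hLdef, card_image_of_injective, card_product]
    rintro ⟨p, w⟩ ⟨p', w'⟩ h
    simp only [Prod.mk.injEq, mul_right_inj' hα, mul_right_inj' hβ] at h
    rw [h.1, h.2]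
  have key := grid_incidences_le (V.image fun v ↦ v⁻¹) A L hL x hx
  have hXc : #(V.image fun v ↦ v⁻¹) = #V := card_image_of_injective _ inv_injective
  rw [hLc, hXc] at key
  push_cast at key
  refine le_trans ?_ key
  rw [← Nat.cast_mul, ← card_product]
  refine Nat.cast_le.2 (card_le_card_of_injOn
    (fun q ↦ ((β * (q.1.2 * q.2), α * q.1.1), q.2⁻¹)) ?_ ?_)
  · rintro ⟨⟨w, w'⟩, v⟩ hq
    simp only [coe_product, Set.mem_prod, coe_filter, mem_product, Set.mem_ofPred_eq,
      mem_coe] at hq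
    obtain ⟨⟨⟨hw, hw'⟩, hA'⟩, hv⟩ := hq
    have hv0 := (hA v (hV hv)).ne'
    simp only [coe_filter, mem_product, Set.mem_ofPred_eq]
    refine ⟨⟨mem_image.2 ⟨(w' * v, w), mem_product.2 ⟨mem_image₂_of_mem (hV' hw') hv, hw⟩, rfl⟩,
      mem_image_of_mem _ hv⟩, ?_⟩
    convert hA' using 1
    field_simp
    ring
  · rintro ⟨⟨w, w'⟩, v⟩ hq ⟨⟨w₁, w₁'⟩, v₁⟩ - h
    simp only [coe_product, Set.mem_prod, coe_filter, mem_product, Set.mem_ofPred_eq,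
      mem_coe] at hq
    have hv0 := (hA v (hV hq.2)).ne'
    simp only [Prod.mk.injEq, mul_right_inj' hα, mul_right_inj' hβ, inv_inj] at h
    obtain ⟨⟨h1, rfl⟩, rfl⟩ := h
    rw [mul_left_inj' hv0] at h1
    rw [h1]

lemma le_of_linear_pairs_inequality {K n τ P k : ℝ} (hK : 1000 ≤ K) (hn : 0 < n)
    (hτ : K ^ 490 ≤ τ) (hnτ : n ≤ 48 * K ^ 7 * τ) (hP : P ≤ K ^ 4 * n)
    (h : k * τ ≤ 3 * (τ / K ^ 15) * (P * τ) + 8 * (τ * n) ^ 2 / (τ / K ^ 15) ^ 2) :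
    k * (48 * K ^ 7) ≤ n * τ := by
  have hK0 : 0 < K := by linarith
  have hτ0 : 0 < τ := lt_of_lt_of_le (by positivity) hτ
  have h1 : 8 * (τ * n) ^ 2 / (τ / K ^ 15) ^ 2 = 8 * n ^ 2 * K ^ 30 := by
    field_simp
  rw [h1] at h
  have h2 : 3 * (τ / K ^ 15) * (P * τ) ≤ 3 * (τ / K ^ 15) * (K ^ 4 * n * τ) := by gcongr
  have h3 : 3 * (τ / K ^ 15) * (K ^ 4 * n * τ) = (3 * n * τ / K ^ 11) * τ := by
    field_simp
  have h4 : 8 * n ^ 2 * K ^ 30 ≤ 8 * n * (48 * K ^ 7 * τ) * K ^ 30 := by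
    rw [sq, ← mul_assoc]; gcongr
  have h5 : k ≤ 3 * n * τ / K ^ 11 + 384 * n * K ^ 37 := by
    refine le_of_mul_le_mul_right ?_ hτ0
    calc k * τ ≤ _ := h
      _ ≤ (3 * n * τ / K ^ 11) * τ + 8 * n * (48 * K ^ 7 * τ) * K ^ 30 := by linarith
      _ = _ := by ring
  have h6 : k * (48 * K ^ 7) ≤ 144 / K ^ 4 * (n * τ) + 18432 * K ^ 44 * n := by
    calc k * (48 * K ^ 7) ≤ (3 * n * τ / K ^ 11 + 384 * n * K ^ 37) * (48 * K ^ 7) := by gcongr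
      _ = _ := by field_simp; ring
  have h7 : 144 / K ^ 4 ≤ 1 / 2 := by
    rw [div_le_div_iff₀ (by positivity) (by norm_num)]
    have : (1000 : ℝ) ^ 4 ≤ K ^ 4 := by gcongr
    norm_num at this
    linarith
  have h8 : 18432 * K ^ 44 ≤ 1 / 2 * τ := by
    have h9 : (1000 : ℝ) ^ 2 ≤ K ^ 2 := by gcongr
    have h10 : K ^ 46 ≤ K ^ 490 := pow_le_pow_right₀ (by linarith) (by norm_num)
    have h11 : K ^ 46 = K ^ 44 * K ^ 2 := by ring
    have h12 : 0 < K ^ 44 := by positivity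
    nlinarith
  calc _ ≤ _ := h6
    _ ≤ 1 / 2 * (n * τ) + 1 / 2 * τ * n := by gcongr
    _ = n * τ := by ring

/-- Few values of `a * b + c` force a large family of slopes, all with small product sets, in which
one finds two separated subfamilies of prescribed size with many coincidences among slope sums. -/
lemma exists_slopes_with_large_energy (A Q : Finset ℝ) (hA : ∀ a ∈ A, 0 < a)
    (hQ : ∀ a ∈ A, ∀ b ∈ A, ∀ c ∈ A, a * b + c ∈ Q) (K : ℕ) (hK : 1000 ≤ K)
    (hlog : Nat.log 2 #A + 1 ≤ K) (hKn : 8 * K ^ 6 ≤ #A) (hQK : #Q ^ 2 < #A ^ 3 * K) :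
    ∃ (τ : ℕ) (V : ℝ → Finset ℝ) (v : ℝ → ℝ), 1 ≤ τ ∧ τ ≤ #A ∧
      ∀ M : ℕ, 1 ≤ M → 8 * K * M ≤ #A → ∃ T₁ T₂ : Finset ℝ, #T₁ = M ∧ #T₂ = M ∧
        (∀ a ∈ T₁, ∀ b ∈ T₂, a < b) ∧ (∀ l ∈ T₁, 0 < v l) ∧
        (∀ m ∈ T₂, V m ⊆ A ∧ #(V m) = τ) ∧
        (∀ m ∈ T₂, #(image₂ (· * ·) A (V m)) ≤ K ^ 4 * #A) ∧
        M ^ 3 * #A * τ ≤ 16 * K ^ 2 * #{p ∈ slopeConfigs A T₁ T₂ V ×ˢ slopeConfigs A T₁ T₂ V |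
          slopeSum v p.1 = slopeSum v p.2} := by
  have hn : 0 < #A := lt_of_lt_of_le (by positivity) hKn
  obtain ⟨τ, Λ, V, hτ, hτn, hV, hnΛ⟩ := exists_popular_slopes A hA (card_pos.1 hn) K hlog
  have hbad : 2 * #{l ∈ Λ | K ^ 4 * #A < #(image₂ (· * ·) A (V l))} ≤ #Λ := by
    by_contra! hcon
    set Λ' := {l ∈ Λ | K ^ 4 * #A < #(image₂ (· * ·) A (V l))} with hΛ'
    have hn2 : #A ^ 2 ≤ 4 * K * τ * #Λ' := by
      calc #A ^ 2 ≤ 2 * K * τ * #Λ := hnΛ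
        _ ≤ 2 * K * τ * (2 * #Λ') := Nat.mul_le_mul_left _ hcon.le
        _ = _ := by ring
    have hΛ2 : 2 ≤ #Λ' := by
      have h1 : #A * #A ≤ #A * (4 * K * #Λ') := by
        calc #A * #A = #A ^ 2 := (sq _).symm
          _ ≤ 4 * K * τ * #Λ' := hn2
          _ ≤ 4 * K * #A * #Λ' := by gcongr
          _ = _ := by ring
      have h2 := Nat.le_of_mul_le_mul_left h1 hn
      have h3 : K * 1 ≤ K * K ^ 5 := Nat.mul_le_mul_left _ (Nat.one_le_pow _ _ (by omega))
      have h4 : K * K ^ 5 = K ^ 6 := by ring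
      by_contra! h5
      have h6 : 4 * K * #Λ' ≤ 4 * K * 1 := Nat.mul_le_mul_left _ (by omega)
      omega
    have h1 := card_mul_le_of_large_products A Q hA hQ Λ' V τ (K ^ 4 * #A)
      (fun l hl ↦ hV l (mem_filter.1 hl).1) (fun l hl ↦ (mem_filter.1 hl).2.le) hΛ2
    have h2 : #A ^ 3 * K ^ 3 < #A ^ 3 * (16 * K) := by
      calc #A ^ 3 * K ^ 3 = #A * K ^ 3 * #A ^ 2 := by ring
        _ ≤ #A * K ^ 3 * (4 * K * τ * #Λ') := Nat.mul_le_mul_left _ hn2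
        _ = 4 * (#Λ' * (K ^ 4 * #A * τ)) := by ring
        _ ≤ 4 * (4 * #Q ^ 2) := Nat.mul_le_mul_left _ h1
        _ < 4 * (4 * (#A ^ 3 * K)) := by omega
        _ = _ := by ring
    have h3 := Nat.lt_of_mul_lt_mul_left h2
    have h4 : 16 * K ≤ K ^ 2 * K := Nat.mul_le_mul_right _ (by nlinarith)
    exact absurd h3 (not_lt.2 h4)
  set Λ' := {l ∈ Λ | ¬ K ^ 4 * #A < #(image₂ (· * ·) A (V l))} with hΛ'
  have hΛcard := card_filter_add_card_filter_not (s := Λ)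
    (fun l ↦ K ^ 4 * #A < #(image₂ (· * ·) A (V l)))
  rw [← hΛ'] at hΛcard
  have hn2 : #A ^ 2 ≤ 4 * K * τ * #Λ' := by
    calc #A ^ 2 ≤ 2 * K * τ * #Λ := hnΛ
      _ ≤ 2 * K * τ * (2 * #Λ') := Nat.mul_le_mul_left _ (by omega)
      _ = _ := by ring
  have hv : ∀ l, ∃ w, l ∈ Λ → w ∈ V l := by
    intro l
    by_cases hl : l ∈ Λ
    · have h1 : (V l).Nonempty := by rw [← card_pos, (hV l hl).2.1]; omega
      exact ⟨h1.choose, fun _ ↦ h1.choose_spec⟩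
    · exact ⟨0, fun h ↦ absurd h hl⟩
  choose v hv using hv
  refine ⟨τ, V, v, hτ, hτn, fun M hM hMn ↦ ?_⟩
  have hΛΛ : Λ' ⊆ Λ := filter_subset _ _
  have hΛM : 2 * M ≤ #Λ' := by
    have h1 : #A * (K * (8 * M)) ≤ #A * (K * (4 * #Λ')) := by
      calc #A * (K * (8 * M)) = #A * (8 * K * M) := by ring
        _ ≤ #A * #A := Nat.mul_le_mul_left _ hMn
        _ = #A ^ 2 := (sq _).symm
        _ ≤ 4 * K * τ * #Λ' := hn2
        _ ≤ 4 * K * #A * #Λ' := by gcongr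
        _ = _ := by ring
    have h2 := Nat.le_of_mul_le_mul_left (Nat.le_of_mul_le_mul_left h1 hn) (by omega)
    omega
  obtain ⟨T₁, hT₁, T₂, hT₂, h₁, h₂, hlt, hE⟩ := exists_large_slopeSum_energy A Q hA hQ Λ' V τ
    (fun l hl ↦ hV l (hΛΛ hl)) v (fun l hl ↦ hv l (hΛΛ hl)) M (16 * K ^ 2 * τ * M * #A) hM hΛM (by
      calc 4 * M * #Q ^ 2 < 4 * M * (#A ^ 3 * K) := Nat.mul_lt_mul_of_pos_left hQK (by omega)
        _ = 4 * M * #A * K * #A ^ 2 := by ring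
        _ ≤ 4 * M * #A * K * (4 * K * τ * #Λ') := Nat.mul_le_mul_left _ hn2
        _ = _ := by ring)
  refine ⟨T₁, T₂, h₁, h₂, hlt, ?_, ?_, ?_, ?_⟩
  · exact fun l hl ↦ hA _ ((hV l (hΛΛ (hT₁ hl))).1 (hv l (hΛΛ (hT₁ hl))))
  · exact fun m hm ↦ ⟨(hV m (hΛΛ (hT₂ hm))).1, (hV m (hΛΛ (hT₂ hm))).2.1⟩
  · exact fun m hm ↦ not_lt.1 (mem_filter.1 (hT₂ hm)).2
  · refine le_of_mul_le_mul_left ?_ (show 0 < τ * M * #A by positivity)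
    calc τ * M * #A * (M ^ 3 * #A * τ) = (M * M * #A * τ) ^ 2 := by ring
      _ ≤ _ := hE
      _ = _ := by ring

lemma card_pow_three_mul_le_sq_card (A Q : Finset ℝ) (hA : ∀ a ∈ A, 0 < a)
    (hQ : ∀ a ∈ A, ∀ b ∈ A, ∀ c ∈ A, a * b + c ∈ Q) (K : ℕ) (hK : 1000 ≤ K)
    (hlog : Nat.log 2 #A + 1 ≤ K) (hKn : K ^ 1000 ≤ #A) :
    #A ^ 3 * K ≤ #Q ^ 2 := by
  by_contra! hQK
  have hK7 : 8 * K ^ 6 ≤ K ^ 7 := by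
    rw [pow_succ' K 6]; exact Nat.mul_le_mul_right _ (by omega)
  have hKp : ∀ j, j ≤ 1000 → K ^ j ≤ #A := fun j hj ↦
    (Nat.pow_le_pow_right (by omega) hj).trans hKn
  have hn : 0 < #A := lt_of_lt_of_le (by norm_num) (hKp 0 (by norm_num))
  obtain ⟨τ, V, v, hτ, hτn, hE⟩ := exists_slopes_with_large_energy A Q hA hQ K hK hlog
    (hK7.trans (hKp 7 (by norm_num))) hQK
  rcases le_or_gt (τ ^ 2 * K ^ 20) #A with hsmall | hlarge
  · -- few multiples for each slope
    set M := Nat.sqrt #A with hM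
    have hMn : M * M ≤ #A := Nat.sqrt_le _
    have hnM : #A < (M + 1) * (M + 1) := Nat.lt_succ_sqrt _
    have hMK : 8 * K ≤ M := by
      rw [hM, Nat.le_sqrt]
      calc 8 * K * (8 * K) = 64 * K ^ 2 := by ring
        _ ≤ K * K ^ 2 := Nat.mul_le_mul_right _ (by omega)
        _ = K ^ 3 := by ring
        _ ≤ #A := hKp 3 (by norm_num)
    obtain ⟨T₁, T₂, h₁, h₂, hlt, hv, hV, -, hE⟩ := hE M (by omega)
      ((Nat.mul_le_mul_right _ hMK).trans hMn)
    have hE1 := card_slopeSum_energy_le A T₁ T₂ V v τ M h₁ h₂ hlt hV hv (τ * τ) (by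
      intro m hm m' hm' α β _ _
      refine (card_filter_le _ _).trans_eq ?_
      rw [card_product, (hV m hm).2, (hV m' hm').2])
    have hE2 := card_slopeSum_energy_same_slope_le A T₁ T₂ V v τ M hA h₂ hV hv
    have hE3 := hE.trans (Nat.mul_le_mul_left _ (hE1.trans (Nat.add_le_add_left hE2 _)))
    have h3 : M * M * #A * τ + τ * τ * (M * M * M * M) + τ * τ * #A * (M * M) ≤
        3 * (M * M * #A * τ ^ 2) := by
      have h4 : M * M * #A * τ ≤ M * M * #A * τ ^ 2 :=
        Nat.mul_le_mul_left _ (Nat.le_self_pow (by norm_num) _)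
      have h5 : τ * τ * (M * M * M * M) ≤ M * M * #A * τ ^ 2 := by
        calc _ = τ * τ * (M * M) * (M * M) := by ring
          _ ≤ τ * τ * (M * M) * #A := Nat.mul_le_mul_left _ hMn
          _ = _ := by ring
      have h6 : τ * τ * #A * (M * M) = M * M * #A * τ ^ 2 := by ring
      omega
    have hMτ : M ≤ 48 * K ^ 2 * τ := by
      refine le_of_mul_le_mul_left ?_ (show 0 < M * M * #A * τ from
        mul_pos (mul_pos (mul_pos (by omega) (by omega)) hn) hτ)
      calc M * M * #A * τ * M = M ^ 3 * #A * τ := by ring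
        _ ≤ _ := hE3
        _ ≤ 16 * K ^ 2 * (3 * (M * M * #A * τ ^ 2)) := Nat.mul_le_mul_left _ h3
        _ = _ := by ring
    have h7 : #A < #A := by
      calc #A < (M + 1) * (M + 1) := hnM
        _ ≤ (2 * (48 * K ^ 2 * τ)) * (2 * (48 * K ^ 2 * τ)) :=
          Nat.mul_le_mul (by omega) (by omega)
        _ = 9216 * (K ^ 4 * τ ^ 2) := by ring
        _ ≤ K ^ 16 * (K ^ 4 * τ ^ 2) := by
          refine Nat.mul_le_mul_right _ ?_
          calc 9216 ≤ 1000 ^ 16 := by norm_num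
            _ ≤ K ^ 16 := Nat.pow_le_pow_left hK 16
        _ = τ ^ 2 * K ^ 20 := by ring
        _ ≤ #A := hsmall
    exact lt_irrefl _ h7
  · -- many multiples for each slope
    have hτK : K ^ 490 ≤ τ := by
      have h1 : (K ^ 490) ^ 2 < τ ^ 2 := by
        refine Nat.lt_of_mul_lt_mul_right (a := K ^ 20) ?_
        calc (K ^ 490) ^ 2 * K ^ 20 = K ^ 1000 := by ring
          _ ≤ #A := hKn
          _ < _ := hlarge
      exact (lt_of_pow_lt_pow_left₀ 2 (by positivity) h1).le
    have hKR : (1000 : ℝ) ≤ K := by exact_mod_cast hK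
    have hnR : (0 : ℝ) < #A := by exact_mod_cast hn
    have hτR : (K : ℝ) ^ 490 ≤ τ := by exact_mod_cast hτK
    set M := K ^ 5 with hM
    have hM1 : 1 ≤ M := Nat.one_le_pow _ _ (by omega)
    obtain ⟨T₁, T₂, h₁, h₂, hlt, hv, hV, hP, hE⟩ := hE M hM1 (by
      calc 8 * K * M = 8 * K ^ 6 := by rw [hM]; ring
        _ ≤ K ^ 7 := hK7
        _ ≤ #A := hKp 7 (by norm_num))
    have hE1 := card_slopeSum_energy_le A T₁ T₂ V v τ M h₁ h₂ hlt hV hv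
      (#A * τ / (48 * K ^ 7)) (by
      intro m hm m' hm' α β hα hβ
      rw [Nat.le_div_iff_mul_le (by positivity)]
      rcases le_or_gt (τ * (48 * K ^ 7)) #A with h | h
      · have h3 : #{p ∈ V m ×ˢ V m' | α * p.1 + β * p.2 ∈ A} ≤ τ * τ := by
          refine (card_filter_le _ _).trans_eq ?_
          rw [card_product, (hV m hm).2, (hV m' hm').2]
        calc _ ≤ τ * τ * (48 * K ^ 7) := Nat.mul_le_mul_right _ h3
          _ = τ * (48 * K ^ 7) * τ := by ring
          _ ≤ #A * τ := Nat.mul_le_mul_right _ h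
      · have hx : (1 : ℝ) ≤ τ / K ^ 15 := by
          rw [one_le_div (by positivity)]
          exact (pow_le_pow_right₀ (by linarith) (by norm_num)).trans hτR
        have h3 := card_linear_pairs_mul_le A (V m) (V m') hA (hV m hm).1 (hV m' hm').1 α β hα hβ
          _ hx
        rw [(hV m hm).2] at h3
        have h4 := le_of_linear_pairs_inequality hKR hnR hτR
          (by
            have h5 : (#A : ℝ) ≤ τ * (48 * K ^ 7) := by exact_mod_cast h.le
            linarith) (by exact_mod_cast hP m hm) h3
        exact_mod_cast h4)
    obtain ⟨m, hm, κ, hκ, hcount⟩ : ∃ m ∈ T₂, ∃ κ : ℝ, κ ≠ 0 ∧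
        #A * τ < #{p ∈ A ×ˢ V m | p.1 + κ * p.2 ∈ A} * K ^ 3 := by
      by_contra! hcon
      have hE2 := card_slopeSum_energy_same_slope_le_of_shift A T₁ T₂ V v M (#A * τ / K ^ 3)
        h₁ h₂ hlt hv fun m hm κ hκ ↦ by
          rw [Nat.le_div_iff_mul_le (by positivity)]
          exact hcon m hm κ hκ
      have hE3 := hE.trans (Nat.mul_le_mul_left _ (hE1.trans (Nat.add_le_add_left hE2 _)))
      have hN := Nat.div_mul_le_self (#A * τ) (48 * K ^ 7)
      have hN' := Nat.div_mul_le_self (#A * τ) (K ^ 3)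
      set N := #A * τ / (48 * K ^ 7)
      set N' := #A * τ / K ^ 3
      have hpos : 0 < #A * τ := mul_pos hn hτ
      have h3 : 3 * (K ^ 15 * (#A * τ)) < 3 * (K ^ 15 * (#A * τ)) := by
        calc 3 * (K ^ 15 * (#A * τ)) = 3 * (M ^ 3 * #A * τ) := by rw [hM]; ring
          _ ≤ 3 * (16 * K ^ 2 * (M * M * #A * τ + N * (M * M * M * M) + N' * (M * M * M))) :=
            Nat.mul_le_mul_left _ hE3
          _ = 48 * (K ^ 12 * (#A * τ)) + K ^ 15 * (N * (48 * K ^ 7)) +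
              48 * (K ^ 14 * (N' * K ^ 3)) := by rw [hM]; ring
          _ ≤ 48 * (K ^ 12 * (#A * τ)) + K ^ 15 * (#A * τ) + 48 * (K ^ 14 * (#A * τ)) := by
            gcongr
          _ ≤ 48 * (K ^ 14 * (#A * τ)) + K ^ 15 * (#A * τ) + 48 * (K ^ 14 * (#A * τ)) := by
            gcongr
            · omega
            · norm_num
          _ = 96 * (K ^ 14 * (#A * τ)) + K ^ 15 * (#A * τ) := by ring
          _ < K * (K ^ 14 * (#A * τ)) + 2 * (K ^ 15 * (#A * τ)) := by
            have h4 : 0 < K ^ 14 * (#A * τ) := mul_pos (pow_pos (by omega) _) hpos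
            have h5 : 96 * (K ^ 14 * (#A * τ)) < K * (K ^ 14 * (#A * τ)) :=
              Nat.mul_lt_mul_of_pos_right (by omega) h4
            omega
          _ = _ := by ring
      exact lt_irrefl _ h3
    have h6 : 6 * (K : ℝ) ^ 30 ≤ τ := by
      calc 6 * (K : ℝ) ^ 30 ≤ (K : ℝ) * (K : ℝ) ^ 30 := by gcongr; linarith
        _ = (K : ℝ) ^ 31 := by ring
        _ ≤ (K : ℝ) ^ 490 := pow_le_pow_right₀ (by linarith) (by norm_num)
        _ ≤ τ := hτR
    have key := card_pow_le_of_almost_periods A (V m) hA (hV m hm).1 K hKR (card_pos.1 hn)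
      (by exact_mod_cast hP m hm) κ hκ (by
        rw [(hV m hm).2]
        have h7 := sum_card_filter_eq_card_filter_product A (V m) fun c w ↦ c + κ * w ∈ A
        rw [← h7, mul_comm _ (K ^ 3)] at hcount
        exact_mod_cast hcount.le) (by rw [(hV m hm).2]; exact h6)
    rw [(hV m hm).2] at key
    have key' : τ ^ 9 ≤ K ^ 291 * #A ^ 4 := by exact_mod_cast key
    have h8 : #A ^ 8 * #A < #A ^ 8 * K ^ 762 := by
      calc #A ^ 8 * #A = #A ^ 9 := by ring
        _ < (τ ^ 2 * K ^ 20) ^ 9 := Nat.pow_lt_pow_left hlarge (by norm_num)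
        _ = (τ ^ 9) ^ 2 * K ^ 180 := by ring
        _ ≤ (K ^ 291 * #A ^ 4) ^ 2 * K ^ 180 := by gcongr
        _ = _ := by ring
    exact absurd (Nat.lt_of_mul_lt_mul_left h8) (not_lt.2 (hKp 762 (by norm_num)))

lemma exists_nat_pow_le_and_log_le :
    ∃ n₁ : ℕ, ∀ n : ℕ, n₁ ≤ n → ∃ K : ℕ, 1000 ≤ K ∧ Nat.log 2 n + 1 ≤ K ∧ K ^ 1000 ≤ n ∧
      (n : ℝ) ^ (1 / 1000 : ℝ) ≤ 2 * K := by
  have h1 : ∀ᶠ x : ℝ in Filter.atTop, ‖Real.log x‖ ≤ 1 / 4 * ‖x ^ (1 / 1000 : ℝ)‖ :=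
    (isLittleO_log_rpow_atTop (by norm_num : (0 : ℝ) < 1 / 1000)).def (by norm_num)
  have h2 : ∀ᶠ x : ℝ in Filter.atTop, (1000 : ℝ) ≤ x ^ (1 / 1000 : ℝ) :=
    (tendsto_rpow_atTop (by norm_num : (0 : ℝ) < 1 / 1000)).eventually_ge_atTop 1000
  obtain ⟨n₁, hn₁⟩ := Filter.eventually_atTop.1 (tendsto_natCast_atTop_atTop.eventually
    ((h1.and h2).and (Filter.eventually_ge_atTop (1 : ℝ))))
  refine ⟨n₁, fun n hn ↦ ?_⟩
  obtain ⟨⟨hlog, hy⟩, hn1⟩ := hn₁ n hn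
  have hn0 : (0 : ℝ) ≤ n := Nat.cast_nonneg n
  set y : ℝ := (n : ℝ) ^ (1 / 1000 : ℝ) with hydef
  have hy0 : 0 ≤ y := by linarith
  rw [Real.norm_of_nonneg (Real.log_nonneg hn1), Real.norm_of_nonneg hy0] at hlog
  have hfloor : (⌊y⌋₊ : ℝ) ≤ y := Nat.floor_le hy0
  have hfloor' : y < ⌊y⌋₊ + 1 := Nat.lt_floor_add_one y
  have hK : 1000 ≤ ⌊y⌋₊ := Nat.le_floor (by exact_mod_cast hy)
  refine ⟨⌊y⌋₊, hK, Nat.le_floor ?_, ?_, ?_⟩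
  · have h3 : ((2 ^ Nat.log 2 n : ℕ) : ℝ) ≤ n :=
      Nat.cast_le.2 (Nat.pow_log_le_self 2 (by rintro rfl; norm_num at hn1))
    push_cast at h3
    have h4 := Real.log_le_log (by positivity) h3
    rw [Real.log_pow] at h4
    have h5 := Real.log_two_gt_d9
    have h6 : (0 : ℝ) ≤ Nat.log 2 n := Nat.cast_nonneg _
    push_cast
    nlinarith
  · have h3 : (⌊y⌋₊ : ℝ) ^ 1000 ≤ (n : ℝ) := by
      calc (⌊y⌋₊ : ℝ) ^ 1000 ≤ (y : ℝ) ^ (1000 : ℕ) := by gcongr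
        _ = (n : ℝ) := by
          rw [hydef, ← Real.rpow_natCast, ← Real.rpow_mul hn0]
          norm_num
    exact_mod_cast h3
  · have h3 : (1000 : ℝ) ≤ ⌊y⌋₊ := by exact_mod_cast hK
    linarith

lemma exists_rpow_card_le_of_pos :
    ∃ n₁ : ℕ, ∀ A Q : Finset ℝ, n₁ ≤ #A → (∀ a ∈ A, 0 < a) →
      (∀ a ∈ A, ∀ b ∈ A, ∀ c ∈ A, a * b + c ∈ Q) →
      (#A : ℝ) ^ (3 / 2 + 1 / 2000 : ℝ) ≤ 2 * #Q := by
  obtain ⟨n₁, hn₁⟩ := exists_nat_pow_le_and_log_le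
  refine ⟨n₁, fun A Q hAn hA hQ ↦ ?_⟩
  obtain ⟨K, hK, hlog, hKn, hyK⟩ := hn₁ _ hAn
  have key : (#A : ℝ) ^ 3 * K ≤ (#Q : ℝ) ^ 2 := by
    exact_mod_cast card_pow_three_mul_le_sq_card A Q hA hQ K hK hlog hKn
  have hn0 : (0 : ℝ) < #A := by
    have h1 : 0 < #A := lt_of_lt_of_le (by positivity) hKn
    exact_mod_cast h1
  rw [← pow_le_pow_iff_left₀ (by positivity) (by positivity) (two_ne_zero)]
  calc ((#A : ℝ) ^ (3 / 2 + 1 / 2000 : ℝ)) ^ 2 = (#A : ℝ) ^ 3 * (#A : ℝ) ^ (1 / 1000 : ℝ) := by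
        rw [← Real.rpow_natCast, ← Real.rpow_mul hn0.le, ← Real.rpow_natCast,
          ← Real.rpow_add hn0]
        norm_num
    _ ≤ (#A : ℝ) ^ 3 * (2 * K) := by gcongr
    _ = 2 * ((#A : ℝ) ^ 3 * K) := by ring
    _ ≤ 2 * (#Q : ℝ) ^ 2 := by gcongr
    _ ≤ (2 * (#Q : ℝ)) ^ 2 := by nlinarith [sq_nonneg (#Q : ℝ)]

lemma exists_rpow_card_le :
    ∃ n₀ : ℕ, 0 < n₀ ∧ ∀ A : Finset ℝ, n₀ ≤ #A →
      1 / 18 * (#A : ℝ) ^ (3 / 2 + 1 / 2000 : ℝ) ≤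
        (#((A ×ˢ A ×ˢ A).image fun p : ℝ × ℝ × ℝ => p.1 * p.2.1 + p.2.2) : ℝ) ∨
      1 / 18 * (#A : ℝ) ^ (3 / 2 + 1 / 2000 : ℝ) ≤
        (#((A ×ˢ A ×ˢ A).image fun p : ℝ × ℝ × ℝ => p.1 * p.2.1 - p.2.2) : ℝ) := by
  obtain ⟨n₁, hn₁⟩ := exists_rpow_card_le_of_pos
  refine ⟨3 * n₁ + 3, by omega, fun A hA ↦ ?_⟩
  have hthird : ∀ B Q : Finset ℝ, #A ≤ 3 * #B → (∀ a ∈ B, 0 < a) →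
      (∀ a ∈ B, ∀ b ∈ B, ∀ c ∈ B, a * b + c ∈ Q) →
      1 / 18 * (#A : ℝ) ^ (3 / 2 + 1 / 2000 : ℝ) ≤ #Q := by
    intro B Q hAB hB hQ
    have h1 := hn₁ B Q (by omega) hB hQ
    have h2 : (#A : ℝ) ≤ 3 * #B := by exact_mod_cast hAB
    have h3 : (3 : ℝ) ^ (3 / 2 + 1 / 2000 : ℝ) ≤ 9 := by
      calc (3 : ℝ) ^ (3 / 2 + 1 / 2000 : ℝ) ≤ (3 : ℝ) ^ (2 : ℝ) :=
            Real.rpow_le_rpow_of_exponent_le (by norm_num) (by norm_num)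
        _ = 9 := by norm_num
    calc 1 / 18 * (#A : ℝ) ^ (3 / 2 + 1 / 2000 : ℝ)
        ≤ 1 / 18 * (3 * (#B : ℝ)) ^ (3 / 2 + 1 / 2000 : ℝ) := by gcongr
      _ = 1 / 18 * ((3 : ℝ) ^ (3 / 2 + 1 / 2000 : ℝ) * (#B : ℝ) ^ (3 / 2 + 1 / 2000 : ℝ)) := by
        rw [Real.mul_rpow (by norm_num) (Nat.cast_nonneg _)]
      _ ≤ 1 / 18 * (9 * (2 * #Q)) := by gcongr
      _ = #Q := by ring
  have hsplit : #A ≤ #{a ∈ A | 0 < a} + #{a ∈ A | a < 0} + 1 := by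
    have h1 : A ⊆ {a ∈ A | 0 < a} ∪ {a ∈ A | a < 0} ∪ {0} := by
      intro a ha
      simp only [mem_union, mem_filter, mem_singleton]
      rcases lt_trichotomy a 0 with h | h | h <;> tauto
    refine (card_le_card h1).trans ((card_union_le _ _).trans ?_)
    rw [card_singleton]
    exact Nat.add_le_add_right (card_union_le _ _) _
  rcases le_total #{a ∈ A | a < 0} #{a ∈ A | 0 < a} with h | h
  · refine Or.inl (hthird {a ∈ A | 0 < a} _ (by omega) (fun a ha ↦ (mem_filter.1 ha).2) ?_)
    intro a ha b hb c hc
    exact mem_image.2 ⟨(a, b, c), mem_product.2 ⟨(mem_filter.1 ha).1,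
      mem_product.2 ⟨(mem_filter.1 hb).1, (mem_filter.1 hc).1⟩⟩, rfl⟩
  · refine Or.inr (hthird ({a ∈ A | a < 0}.image fun a ↦ -a) _ ?_ ?_ ?_)
    · rw [card_image_of_injective _ neg_injective]
      omega
    · intro a ha
      obtain ⟨b, hb, rfl⟩ := mem_image.1 ha
      exact neg_pos.2 (mem_filter.1 hb).2
    · intro a ha b hb c hc
      obtain ⟨a', ha', rfl⟩ := mem_image.1 ha
      obtain ⟨b', hb', rfl⟩ := mem_image.1 hb
      obtain ⟨c', hc', rfl⟩ := mem_image.1 hc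
      exact mem_image.2 ⟨(a', b', c'), mem_product.2 ⟨(mem_filter.1 ha').1,
        mem_product.2 ⟨(mem_filter.1 hb').1, (mem_filter.1 hc').1⟩⟩, by ring⟩

end SumProduct

/-- There exist `c > 0`, `C > 0` and a positive integer `n₀` such that for every finite
set `A` of reals with `|A| ≥ n₀`, at least one of `|AA+A| ≥ C·|A|^(3/2+c)` and
`|AA−A| ≥ C·|A|^(3/2+c)` holds; in particular the maximum of the two sizes is at least
`C·|A|^(3/2+c)`. -/
theorem lower_bound_max_AA_add_A_AA_sub_A :
    ∃ c : ℝ, 0 < c ∧ ∃ C : ℝ, 0 < C ∧ ∃ n₀ : ℕ, 0 < n₀ ∧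
      ∀ A : Finset ℝ, n₀ ≤ A.card →
        (C * (A.card : ℝ) ^ ((3 : ℝ) / 2 + c) ≤
            (((A ×ˢ A ×ˢ A).image
              (fun p : ℝ × ℝ × ℝ => p.1 * p.2.1 + p.2.2)).card : ℝ) ∨
          C * (A.card : ℝ) ^ ((3 : ℝ) / 2 + c) ≤
            (((A ×ˢ A ×ˢ A).image
              (fun p : ℝ × ℝ × ℝ => p.1 * p.2.1 - p.2.2)).card : ℝ)) ∧
        C * (A.card : ℝ) ^ ((3 : ℝ) / 2 + c) ≤
          max (((A ×ˢ A ×ˢ A).image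
              (fun p : ℝ × ℝ × ℝ => p.1 * p.2.1 + p.2.2)).card : ℝ)
            (((A ×ˢ A ×ˢ A).image
              (fun p : ℝ × ℝ × ℝ => p.1 * p.2.1 - p.2.2)).card : ℝ) := by
  obtain ⟨n₀, hn₀, h⟩ := exists_rpow_card_le
  refine ⟨1 / 2000, by norm_num, 1 / 18, by norm_num, n₀, hn₀, fun A hA ↦ ⟨h A hA, ?_⟩⟩
  exact le_max_iff.2 (h A hA)
end

section
/- Let A be a finite nonempty set of positive real numbers such that |a − b| ≥ 1 for all distinct a, b ∈ A. Then |AA+A| ≥ |A|². -/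
/-- Let `A` be a finite nonempty set of positive reals with `|a − b| ≥ 1` for all
distinct `a, b ∈ A`. Then `|AA+A| ≥ |A|²`. -/
theorem AA_add_A_card_ge_sq_of_separated (A : Finset ℝ) (hA : A.Nonempty)
    (hpos : ∀ a ∈ A, 0 < a)
    (hsep : ∀ a ∈ A, ∀ b ∈ A, a ≠ b → 1 ≤ |a - b|) :
    (A.card ^ 2 : ℕ) ≤ ((A ×ˢ A ×ˢ A).image
      (fun p : ℝ × ℝ × ℝ => p.1 * p.2.1 + p.2.2)).card := by
  obtain ⟨M, hM, hmax⟩ := A.exists_max_image id hA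
  simp only [id] at hmax
  rw [sq, ← Finset.card_product]
  refine Finset.card_le_card_of_injOn (fun q : ℝ × ℝ => q.1 * M + q.2) ?_ ?_
  · rintro ⟨a, c⟩ h
    have h' := Finset.mem_product.1 h
    exact Finset.mem_image.2 ⟨(a, M, c), by simp_all, rfl⟩
  · rintro ⟨a, c⟩ h ⟨b, d⟩ h' heq
    obtain ⟨ha, hc⟩ := Finset.mem_product.1 h
    obtain ⟨hb, hd⟩ := Finset.mem_product.1 h'
    dsimp only at ha hb hc hd heq
    have hab : a = b := by
      by_contra hne
      have hM0 := hpos M hM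
      have hc0 := hpos c hc
      have hd0 := hpos d hd
      have hcM := hmax c hc
      have hdM := hmax d hd
      rcases le_abs.1 (hsep a ha b hb hne) with h1 | h1 <;> nlinarith
    subst hab
    simpa using heq
end

section
/- For every finite set X of real numbers and all nonzero real numbers α and β, the number of triples (x₁, x₂, x₃) ∈ X³ satisfying x₁ = α·x₂ + β·x₃ is at most |X|^(1/2)·E₊(X)^(1/2). -/
/-- The additive energy of a finite set of reals: the number of quadruples
`(x₁,x₂,x₃,x₄) ∈ X⁴` with `x₁ + x₂ = x₃ + x₄`. -/
noncomputable def addEnergy (X : Finset ℝ) : ℕ :=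
  ((X ×ˢ X ×ˢ X ×ˢ X).filter
    (fun p : ℝ × ℝ × ℝ × ℝ => p.1 + p.2.1 = p.2.2.1 + p.2.2.2)).card

/-- Coincidences `f p = g q` between two families, counted by their common value. -/
theorem card_filter_eq_sum_mul_card_fiber {ι κ γ : Type*} [DecidableEq γ]
    (s : Finset ι) (t : Finset κ) (f : ι → γ) (g : κ → γ) (U : Finset γ)
    (hU : ∀ p ∈ s, f p ∈ U) :
    ((s ×ˢ t).filter (fun x : ι × κ => f x.1 = g x.2)).card =
      ∑ d ∈ U, (s.filter (fun p => f p = d)).card * (t.filter (fun q => g q = d)).card := by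
  rw [Finset.card_eq_sum_card_fiberwise (f := fun x : ι × κ => f x.1) (t := U)]
  · refine Finset.sum_congr rfl fun d _ => ?_
    rw [← Finset.card_product]
    congr 1
    ext ⟨p, q⟩
    simp only [Finset.mem_filter, Finset.mem_product]
    grind
  · intro x hx
    simp only [Finset.coe_filter, Finset.mem_product, Set.mem_ofPred_eq] at hx
    exact hU _ hx.1.1

/-- Cauchy–Schwarz for counting coincidences between two families. -/
theorem sq_card_filter_eq_le {ι κ γ : Type*} [DecidableEq γ]
    (s : Finset ι) (t : Finset κ) (f : ι → γ) (g : κ → γ) :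
    ((s ×ˢ t).filter (fun x : ι × κ => f x.1 = g x.2)).card ^ 2 ≤
      ((s ×ˢ s).filter (fun x : ι × ι => f x.1 = f x.2)).card *
        ((t ×ˢ t).filter (fun x : κ × κ => g x.1 = g x.2)).card := by
  have hf : ∀ p ∈ s, f p ∈ s.image f ∪ t.image g := fun p hp =>
    Finset.mem_union_left _ (Finset.mem_image_of_mem f hp)
  have hg : ∀ q ∈ t, g q ∈ s.image f ∪ t.image g := fun q hq =>
    Finset.mem_union_right _ (Finset.mem_image_of_mem g hq)
  rw [card_filter_eq_sum_mul_card_fiber s t f g _ hf,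
    card_filter_eq_sum_mul_card_fiber s s f f _ hf,
    card_filter_eq_sum_mul_card_fiber t t g g _ hg]
  simp only [← sq]
  exact Finset.sum_mul_sq_le_sq_mul_sq _ _ _

/-- Pairs of pairs in `X` with equal dilated differences are counted by the additive energy. -/
theorem card_filter_mul_sub_eq_addEnergy (X : Finset ℝ) {c : ℝ} (hc : c ≠ 0) :
    (((X ×ˢ X) ×ˢ (X ×ˢ X)).filter (fun x : (ℝ × ℝ) × (ℝ × ℝ) =>
      c * (x.1.1 - x.1.2) = c * (x.2.1 - x.2.2))).card = addEnergy X := by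
  refine Finset.card_bij' (fun x _ => (x.1.1, x.2.2, x.1.2, x.2.1))
    (fun y _ => ((y.1, y.2.2.1), (y.2.2.2, y.2.1))) ?_ ?_ (fun _ _ => rfl) (fun _ _ => rfl)
  · rintro ⟨⟨a, b⟩, d, e⟩ h
    simp only [Finset.mem_filter, Finset.mem_product, mul_right_inj' hc] at h ⊢
    exact ⟨by tauto, by linarith [h.2]⟩
  · rintro ⟨a, e, b, d⟩ h
    simp only [Finset.mem_filter, Finset.mem_product, mul_right_inj' hc] at h ⊢
    exact ⟨by tauto, by linarith [h.2]⟩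

/-- The number of solutions in `X` of `α b + β c = α b' + β c'` is at most the additive energy. -/
theorem card_filter_linear_eq_le_addEnergy (X : Finset ℝ) {α β : ℝ} (hα : α ≠ 0) (hβ : β ≠ 0) :
    (((X ×ˢ X) ×ˢ (X ×ˢ X)).filter (fun x : (ℝ × ℝ) × (ℝ × ℝ) =>
      α * x.1.1 + β * x.1.2 = α * x.2.1 + β * x.2.2)).card ≤ addEnergy X := by
  have h := sq_card_filter_eq_le (X ×ˢ X) (X ×ˢ X)
    (fun p : ℝ × ℝ => α * (p.1 - p.2)) (fun p : ℝ × ℝ => β * (p.1 - p.2))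
  rw [card_filter_mul_sub_eq_addEnergy X hα, card_filter_mul_sub_eq_addEnergy X hβ, ← sq] at h
  refine le_trans (le_of_eq ?_) ((Nat.pow_le_pow_iff_left two_ne_zero).1 h)
  refine Finset.card_bij' (fun x _ => ((x.1.1, x.2.1), (x.2.2, x.1.2)))
    (fun y _ => ((y.1.1, y.2.2), (y.1.2, y.2.1))) ?_ ?_ (fun _ _ => rfl) (fun _ _ => rfl)
  · rintro ⟨⟨a, b⟩, d, e⟩ h
    simp only [Finset.mem_filter, Finset.mem_product] at h ⊢
    exact ⟨by tauto, by linarith [h.2]⟩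
  · rintro ⟨⟨a, d⟩, e, b⟩ h
    simp only [Finset.mem_filter, Finset.mem_product] at h ⊢
    exact ⟨by tauto, by linarith [h.2]⟩

/-- For every finite set `X` of reals and nonzero reals `α`, `β`, the number of triples
`(x₁, x₂, x₃) ∈ X³` with `x₁ = α·x₂ + β·x₃` is at most `|X|^(1/2)·E₊(X)^(1/2)`. -/
theorem count_linear_triples_le (X : Finset ℝ) (α β : ℝ) (hα : α ≠ 0) (hβ : β ≠ 0) :
    ((((X ×ˢ X ×ˢ X).filter
        (fun p : ℝ × ℝ × ℝ => p.1 = α * p.2.1 + β * p.2.2)).card : ℝ)) ≤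
      (X.card : ℝ) ^ ((1 : ℝ) / 2) * (addEnergy X : ℝ) ^ ((1 : ℝ) / 2) := by
  have hdiag : ((X ×ˢ X).filter (fun x : ℝ × ℝ => x.1 = x.2)).card = X.card := by
    rw [← X.diag_card]
    congr 1
    ext ⟨a, b⟩
    simp only [Finset.mem_filter, Finset.mem_product, Finset.mem_diag]
    grind
  have h := sq_card_filter_eq_le X (X ×ˢ X) (fun x => x) (fun p : ℝ × ℝ => α * p.1 + β * p.2)
  rw [hdiag] at h
  have h' := h.trans (Nat.mul_le_mul_left _ (card_filter_linear_eq_le_addEnergy X hα hβ))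
  rw [← Real.sqrt_eq_rpow, ← Real.sqrt_eq_rpow, ← Real.sqrt_mul (Nat.cast_nonneg _)]
  apply Real.le_sqrt_of_sq_le
  exact_mod_cast h'
end

section
/- Let y > 2 be a real number, let q = ∏_{p prime, p < y} p and let μ = Σ_{p prime, p < y} 1/p. Then for every nonnegative integer a, Σ_{x = a+1}^{a+q} (f(x) − μ)² = q · Σ_{p prime, p < y} (1/p)·(1 − 1/p). -/
open scoped Classical in
/-- The finite set of primes `p < y`. -/
noncomputable def primesLT (y : ℝ) : Finset ℕ :=
  (Finset.range (Nat.ceil y)).filter (fun p => Nat.Prime p ∧ (p : ℝ) < y)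

open scoped Classical in
/-- `f x` is the number of primes `p < y` dividing `x`. -/
noncomputable def fCount (y : ℝ) (x : ℕ) : ℕ :=
  ((primesLT y).filter (fun p => p ∣ x)).card

/-- A positive divisor `d` of `q` has `q / d` multiples among any `q` consecutive integers. -/
lemma sum_Icc_ite_dvd {d q : ℕ} (hd : 0 < d) (hdq : d ∣ q) (a : ℕ) :
    ∑ x ∈ Finset.Icc (a + 1) (a + q), (if d ∣ x then (1 : ℝ) else 0) = (q : ℝ) / d := by
  obtain ⟨k, rfl⟩ := hdq
  have h : ((Finset.Ioc a (a + d * k)).filter (d ∣ ·)).card = k := by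
    have hc := Nat.Ioc_filter_modEq_card a (a + d * k) hd 0
    have hdℚ : (d : ℚ) ≠ 0 := by exact_mod_cast hd.ne'
    simp only [Nat.modEq_zero_iff_dvd, Nat.cast_zero, sub_zero] at hc
    have hk : ((a + d * k : ℕ) : ℚ) / d = (a : ℚ) / d + k := by
      push_cast
      field_simp
    rw [hk, Int.floor_add_natCast] at hc
    simpa using hc
  rw [Finset.sum_boole, Finset.Icc_add_one_left_eq_Ioc, h]
  have hdℝ : (d : ℝ) ≠ 0 := by exact_mod_cast hd.ne'
  push_cast
  field_simp

/-- The centred divisibility indicators of two primes dividing `q` are uncorrelated over any `q`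
consecutive integers, and each has variance `(1 / p) * (1 - 1 / p)`. -/
lemma sum_Icc_ite_dvd_sub_mul {p r q : ℕ} (hp : p.Prime) (hr : r.Prime) (hpq : p ∣ q)
    (hrq : r ∣ q) (a : ℕ) :
    ∑ x ∈ Finset.Icc (a + 1) (a + q),
        ((if p ∣ x then (1 : ℝ) else 0) - 1 / p) * ((if r ∣ x then (1 : ℝ) else 0) - 1 / r) =
      if p = r then (q : ℝ) * ((1 / (p : ℝ)) * (1 - 1 / (p : ℝ))) else 0 := by
  have hlcm : ∀ x, (if p ∣ x then (1 : ℝ) else 0) * (if r ∣ x then (1 : ℝ) else 0) =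
      if p.lcm r ∣ x then 1 else 0 := by
    intro x
    simp only [Nat.lcm_dvd_iff, ite_zero_mul_ite_zero, one_mul]
  have hexp : ∀ x, ((if p ∣ x then (1 : ℝ) else 0) - 1 / p) *
      ((if r ∣ x then (1 : ℝ) else 0) - 1 / r) =
      (if p.lcm r ∣ x then (1 : ℝ) else 0) - (if p ∣ x then (1 : ℝ) else 0) * (1 / r)
        - (if r ∣ x then (1 : ℝ) else 0) * (1 / p) + 1 / p * (1 / r) := by
    intro x
    rw [← hlcm]
    ring
  simp only [hexp, Finset.sum_add_distrib, Finset.sum_sub_distrib, ← Finset.sum_mul,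
    sum_Icc_ite_dvd hp.pos hpq, sum_Icc_ite_dvd hr.pos hrq,
    sum_Icc_ite_dvd (Nat.lcm_pos hp.pos hr.pos) (Nat.lcm_dvd hpq hrq)]
  have hcard : a + q + 1 - (a + 1) = q := by omega
  simp only [Finset.sum_const, Nat.card_Icc, hcard, nsmul_eq_mul]
  have hp0 : (p : ℝ) ≠ 0 := by exact_mod_cast hp.ne_zero
  have hr0 : (r : ℝ) ≠ 0 := by exact_mod_cast hr.ne_zero
  split_ifs with h
  · subst h
    rw [Nat.lcm_self]
    field_simp
    ring
  · rw [((Nat.coprime_primes hp hr).2 h).lcm_eq_mul]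
    push_cast
    field_simp
    ring

/-- For `y > 2`, `q = ∏_{p prime, p < y} p` and `μ = Σ_{p prime, p < y} 1/p`, for every
nonnegative integer `a`,
`Σ_{x = a+1}^{a+q} (f(x) − μ)² = q · Σ_{p prime, p < y} (1/p)·(1 − 1/p)`. -/
theorem sum_sq_dev_fCount_over_period (y : ℝ) (hy : 2 < y) (q : ℕ)
    (hq : q = ∏ p ∈ primesLT y, p) (μ : ℝ)
    (hμ : μ = ∑ p ∈ primesLT y, (1 : ℝ) / p) (a : ℕ) :
    ∑ x ∈ Finset.Icc (a + 1) (a + q), ((fCount y x : ℝ) - μ) ^ 2 =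
      (q : ℝ) * ∑ p ∈ primesLT y, (1 / (p : ℝ)) * (1 - 1 / (p : ℝ)) := by
  have hprime : ∀ p ∈ primesLT y, p.Prime := fun p hp => (Finset.mem_filter.1 hp).2.1
  have hdvd : ∀ p ∈ primesLT y, p ∣ q := fun p hp => hq ▸ Finset.dvd_prod_of_mem _ hp
  have hdev : ∀ x, (fCount y x : ℝ) - μ =
      ∑ p ∈ primesLT y, ((if p ∣ x then (1 : ℝ) else 0) - 1 / p) := by
    intro x
    rw [Finset.sum_sub_distrib, ← hμ, Finset.sum_boole, fCount]
  simp only [hdev, sq, Finset.sum_mul_sum]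
  rw [Finset.sum_comm, Finset.mul_sum]
  refine Finset.sum_congr rfl fun p hp => ?_
  rw [Finset.sum_comm, Finset.sum_congr rfl fun r hr =>
    sum_Icc_ite_dvd_sub_mul (hprime p hp) (hprime r hr) (hdvd p hp) (hdvd r hr) a,
    Finset.sum_ite_eq, if_pos hp]
end

section
/- Let y > 2 be a real number and let q = ∏_{p prime, p < y} p. Then Σ_{x = 1}^{q²} 2^{g(x)} = ∏_{p prime, p < y} (p² + p + 2). -/
/-- `g x = Σ_{p prime, p < y} min(v_p(x), 2)`. -/
noncomputable def gCount (y : ℝ) (x : ℕ) : ℕ :=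
  ∑ p ∈ primesLT y, min (x.factorization p) 2

open Finset in
/-- The sum of a product of two periodic functions with coprime periods factors. -/
theorem sum_range_mul_of_periodic {R : Type*} [CommSemiring R] {f g : ℕ → R} {m n : ℕ}
    (hm : 0 < m) (hn : 0 < n) (hf : Function.Periodic f m) (hg : Function.Periodic g n)
    (h : m.Coprime n) :
    ∑ x ∈ range (m * n), f x * g x = (∑ x ∈ range m, f x) * ∑ x ∈ range n, g x := by
  rw [sum_mul_sum, ← sum_product']
  refine sum_nbij' (fun x => (x % m, x % n)) (fun a => (Nat.chineseRemainder h a.1 a.2 : ℕ))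
    ?_ ?_ ?_ ?_ ?_
  · intro x _
    simp [Nat.mod_lt, hm, hn]
  · intro a _
    simpa using Nat.chineseRemainder_lt_mul h a.1 a.2 hm.ne' hn.ne'
  · intro x hx
    have hmod := Nat.chineseRemainder_modEq_unique h (Nat.mod_modEq x m).symm
      (Nat.mod_modEq x n).symm
    exact (hmod.eq_of_lt_of_lt (mem_range.1 hx)
      (Nat.chineseRemainder_lt_mul h _ _ hm.ne' hn.ne')).symm
  · rintro ⟨a, b⟩ hab
    simp only [mem_product, mem_range] at hab
    obtain ⟨k, hk₁, hk₂⟩ := Nat.chineseRemainder h a b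
    exact Prod.ext (Nat.mod_eq_of_modEq hk₁ hab.1) (Nat.mod_eq_of_modEq hk₂ hab.2)
  · intro x _
    simp only [hf.map_mod_nat, hg.map_mod_nat]

open Finset in
/-- The sum of a product of periodic functions with pairwise coprime periods factors. -/
theorem sum_range_prod_of_periodic {ι R : Type*} [CommSemiring R] (s : Finset ι)
    {f : ι → ℕ → R} {m : ι → ℕ} (hm : ∀ i ∈ s, 0 < m i)
    (hf : ∀ i ∈ s, Function.Periodic (f i) (m i))
    (h : (s : Set ι).Pairwise (Function.onFun Nat.Coprime m)) :
    ∑ x ∈ range (∏ i ∈ s, m i), ∏ i ∈ s, f i x = ∏ i ∈ s, ∑ x ∈ range (m i), f i x := by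
  classical
  induction s using Finset.induction_on with
  | empty => simp
  | insert a s ha ih =>
    have hper : Function.Periodic (fun x => ∏ i ∈ s, f i x) (∏ i ∈ s, m i) := by
      intro x
      refine prod_congr rfl fun i hi => ?_
      obtain ⟨k, hk⟩ := dvd_prod_of_mem m hi
      rw [hk, mul_comm]
      exact (hf i (mem_insert_of_mem hi)).nat_mul k x
    have hcop : (m a).Coprime (∏ i ∈ s, m i) :=
      Nat.Coprime.prod_right fun i hi =>
        h (mem_insert_self a s) (mem_insert_of_mem hi) (ne_of_mem_of_not_mem hi ha).symm
    simp only [prod_insert ha]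
    rw [sum_range_mul_of_periodic (hm a (mem_insert_self a s))
      (prod_pos fun i hi => hm i (mem_insert_of_mem hi)) (hf a (mem_insert_self a s)) hper hcop,
      ih (fun i hi => hm i (mem_insert_of_mem hi)) (fun i hi => hf i (mem_insert_of_mem hi))
        (h.mono (by simp))]

open Finset in
theorem sum_Ioc_eq_sum_range_of_map_eq {M : Type*} [AddCommMonoid M] {f : ℕ → M} {n : ℕ}
    (h : f n = f 0) : ∑ x ∈ Ioc 0 n, f x = ∑ x ∈ range n, f x := by
  cases n with
  | zero => simp
  | succ n =>
    rw [sum_range_succ', ← h, ← sum_range_succ (fun k => f (k + 1)), range_eq_Ico,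
      sum_Ico_add' f 0 (n + 1) 1]
    rfl

/-- The weight `1 + [p ∣ x] + 2 [p² ∣ x]`, which is `2 ^ min (v_p(x)) 2` for nonzero `x`. -/
def dvdWeight (p x : ℕ) : ℕ :=
  1 + (if p ∣ x then 1 else 0) + 2 * (if p ^ 2 ∣ x then 1 else 0)

theorem dvdWeight_periodic (p : ℕ) : Function.Periodic (dvdWeight p) (p ^ 2) := by
  intro x
  simp [dvdWeight, Nat.dvd_add_left (dvd_pow_self p two_ne_zero)]

theorem two_pow_min_factorization {p x : ℕ} (hp : p.Prime) (hx : x ≠ 0) :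
    2 ^ min (x.factorization p) 2 = dvdWeight p x := by
  have h₁ : p ∣ x ↔ 1 ≤ x.factorization p := by
    simpa using hp.pow_dvd_iff_le_factorization (k := 1) hx
  simp only [dvdWeight, h₁, hp.pow_dvd_iff_le_factorization hx]
  generalize x.factorization p = v
  obtain rfl | rfl | hv : v = 0 ∨ v = 1 ∨ 2 ≤ v := by lia
  · simp
  · simp
  · simp [hv, one_le_two.trans hv]

open Finset in
theorem sum_range_dvdWeight {p : ℕ} (hp : 0 < p) :
    ∑ x ∈ range (p ^ 2), dvdWeight p x = p ^ 2 + p + 2 := by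
  rw [← sum_Ioc_eq_sum_range_of_map_eq (dvdWeight_periodic p).eq]
  simp only [dvdWeight, sum_add_distrib, ← mul_sum, ← card_filter,
    Nat.Ioc_filter_dvd_card_eq_div]
  rw [Nat.div_self (by positivity), sq, Nat.mul_div_cancel _ hp]
  simp

theorem prime_of_mem_primesLT {y : ℝ} {p : ℕ} (hp : p ∈ primesLT y) : p.Prime :=
  (Finset.mem_filter.1 hp).2.1

/-- For `y > 2` and `q = ∏_{p prime, p < y} p`,
`Σ_{x = 1}^{q²} 2^{g(x)} = ∏_{p prime, p < y} (p² + p + 2)`. -/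
theorem sum_two_pow_gCount (y : ℝ) (hy : 2 < y) (q : ℕ)
    (hq : q = ∏ p ∈ primesLT y, p) :
    ∑ x ∈ Finset.Icc 1 (q ^ 2), 2 ^ gCount y x =
      ∏ p ∈ primesLT y, (p ^ 2 + p + 2) := by
  have hpos : ∀ p ∈ primesLT y, 0 < p := fun p hp => (prime_of_mem_primesLT hp).pos
  have hq' : q ^ 2 = ∏ p ∈ primesLT y, p ^ 2 := by rw [hq, Finset.prod_pow]
  have hweight : ∀ x ∈ Finset.Ioc 0 (q ^ 2),
      2 ^ gCount y x = ∏ p ∈ primesLT y, dvdWeight p x := by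
    intro x hx
    rw [gCount, ← Finset.prod_pow_eq_pow_sum]
    exact Finset.prod_congr rfl fun p hp =>
      two_pow_min_factorization (prime_of_mem_primesLT hp) (Finset.mem_Ioc.1 hx).1.ne'
  have hends : ∏ p ∈ primesLT y, dvdWeight p (q ^ 2) = ∏ p ∈ primesLT y, dvdWeight p 0 := by
    refine Finset.prod_congr rfl fun p hp => ?_
    have hpq : p ∣ q := hq ▸ Finset.dvd_prod_of_mem _ hp
    simp [dvdWeight, pow_dvd_pow_of_dvd hpq 2, dvd_pow hpq two_ne_zero]
  change ∑ x ∈ Finset.Ioc 0 (q ^ 2), 2 ^ gCount y x = _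
  rw [Finset.sum_congr rfl hweight, sum_Ioc_eq_sum_range_of_map_eq hends, hq',
    sum_range_prod_of_periodic _ (fun p hp => pow_pos (hpos p hp) 2)
      (fun p _ => dvdWeight_periodic p)]
  · exact Finset.prod_congr rfl fun p hp => sum_range_dvdWeight (hpos p hp)
  · intro p hp r hr hpr
    exact Nat.Coprime.pow 2 2 ((Nat.coprime_primes (prime_of_mem_primesLT hp)
      (prime_of_mem_primesLT hr)).2 hpr)
end

section
/- For every ε > 0 there exists a constant C > 0 such that for every integer n ≥ 16 there exist a set A of n positive integers and a positive integer m with |AA + mA| ≤ C·n²·(log log n)^(1 − 2·ln 2 + ε). -/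
/-- The number of elements of `s` dividing `a`. -/
def divisorCount (s : Finset ℕ) (a : ℕ) : ℕ := {p ∈ s | p ∣ a}.card

/-- The product over `p ∈ s` of `2 ^ v`, where `v` is the `p`-adic valuation of `x` truncated
at `2`. -/
def truncatedWeight (s : Finset ℕ) (x : ℕ) : ℝ :=
  ∏ p ∈ s, (1 + (if p ∣ x then 1 else 0) + (if p ^ 2 ∣ x then 2 else 0))

theorem truncatedWeight_nonneg (s : Finset ℕ) (x : ℕ) : 0 ≤ truncatedWeight s x :=
  Finset.prod_nonneg fun p _ ↦ by positivity

theorem truncatedWeight_mul_of_coprime {s : Finset ℕ} {d : ℕ} (h : ∀ p ∈ s, p.Coprime d) (x : ℕ) :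
    truncatedWeight s (d * x) = truncatedWeight s x := by
  refine Finset.prod_congr rfl fun p hp ↦ ?_
  simp only [(h p hp).dvd_mul_left, ((h p hp).pow_left 2).dvd_mul_left]

theorem sum_Ioc_filter_dvd (f : ℕ → ℝ) (d Z : ℕ) (hd : 0 < d) :
    ∑ x ∈ Finset.Ioc 0 Z with d ∣ x, f x = ∑ x ∈ Finset.Ioc 0 (Z / d), f (d * x) := by
  symm
  refine Finset.sum_bij (fun x _ ↦ d * x) ?_ ?_ ?_ ?_
  · intro x hx
    simp only [Finset.mem_Ioc, Finset.mem_filter] at hx ⊢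
    refine ⟨⟨Nat.mul_pos hd hx.1, ?_⟩, dvd_mul_right _ _⟩
    rw [mul_comm]
    exact (Nat.le_div_iff_mul_le hd).1 hx.2
  · intro x _ y _ h
    exact Nat.eq_of_mul_eq_mul_left hd h
  · rintro x hx
    simp only [Finset.mem_Ioc, Finset.mem_filter] at hx
    obtain ⟨⟨h0, h1⟩, k, rfl⟩ := hx
    refine ⟨k, ?_, rfl⟩
    simp only [Finset.mem_Ioc]
    refine ⟨Nat.pos_of_mul_pos_left h0, (Nat.le_div_iff_mul_le hd).2 ?_⟩
    rwa [mul_comm]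
  · intros; rfl

theorem sum_truncatedWeight_le (s : Finset ℕ) (hs : ∀ p ∈ s, p.Prime) (Z : ℕ) :
    ∑ x ∈ Finset.Ioc 0 Z, truncatedWeight s x ≤
      Z * ∏ p ∈ s, (1 + (p : ℝ)⁻¹ + 2 * ((p : ℝ) ^ 2)⁻¹) := by
  induction s using Finset.induction_on generalizing Z with
  | empty => simp [truncatedWeight]
  | insert p s hp ih =>
    have hpp : p.Prime := hs p (Finset.mem_insert_self _ _)
    have hs' : ∀ q ∈ s, q.Prime := fun q hq ↦ hs q (Finset.mem_insert_of_mem hq)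
    have hcop : ∀ q ∈ s, q.Coprime p := fun q hq ↦
      (Nat.coprime_primes (hs' q hq) hpp).2 fun h ↦ hp (h ▸ hq)
    set M : ℝ := ∏ p ∈ s, (1 + (p : ℝ)⁻¹ + 2 * ((p : ℝ) ^ 2)⁻¹) with hM
    have hM0 : 0 ≤ M := Finset.prod_nonneg fun q _ ↦ by positivity
    have key : ∀ d : ℕ, 0 < d → (∀ q ∈ s, q.Coprime d) →
        ∑ x ∈ Finset.Ioc 0 Z with d ∣ x, truncatedWeight s x ≤ Z * (d : ℝ)⁻¹ * M := by
      intro d hd hc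
      rw [sum_Ioc_filter_dvd _ _ _ hd]
      simp only [truncatedWeight_mul_of_coprime hc]
      refine (ih hs' (Z / d)).trans ?_
      gcongr
      rw [← div_eq_mul_inv]
      exact Nat.cast_div_le
    have h1 := key p hpp.pos hcop
    have h2 := key (p ^ 2) (pow_pos hpp.pos 2) fun q hq ↦ (hcop q hq).pow_right 2
    have h0 := ih hs' Z
    have expand : ∑ x ∈ Finset.Ioc 0 Z, truncatedWeight (insert p s) x =
        ∑ x ∈ Finset.Ioc 0 Z, truncatedWeight s x +
        ∑ x ∈ Finset.Ioc 0 Z with p ∣ x, truncatedWeight s x +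
        2 * ∑ x ∈ Finset.Ioc 0 Z with p ^ 2 ∣ x, truncatedWeight s x := by
      rw [Finset.sum_filter, Finset.sum_filter, Finset.mul_sum, ← Finset.sum_add_distrib,
        ← Finset.sum_add_distrib]
      refine Finset.sum_congr rfl fun x _ ↦ ?_
      rw [truncatedWeight, Finset.prod_insert hp, ← truncatedWeight]
      split_ifs <;> ring
    rw [expand, Finset.prod_insert hp, ← hM]
    push_cast at h2
    linarith

theorem two_pow_divisorCount (s : Finset ℕ) (a : ℕ) :
    (2 : ℝ) ^ divisorCount s a = ∏ p ∈ s, if p ∣ a then 2 else 1 := by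
  rw [divisorCount, ← Finset.prod_const, Finset.prod_filter]

theorem two_pow_le_truncatedWeight {s : Finset ℕ} {m : ℕ} (hm : ∀ p ∈ s, p ^ 2 ∣ m) (a b c : ℕ) :
    (2 : ℝ) ^ (divisorCount s a + divisorCount s b) ≤ truncatedWeight s (a * b + m * c) := by
  rw [pow_add, two_pow_divisorCount, two_pow_divisorCount, ← Finset.prod_mul_distrib]
  refine Finset.prod_le_prod (fun p _ ↦ by positivity) fun p hp ↦ ?_
  have h2 : p ^ 2 ∣ m * c := (hm p hp).mul_right c
  have h1 : p ∣ m * c := (dvd_pow_self p two_ne_zero).trans h2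
  simp only [← Nat.dvd_add_iff_left h1, ← Nat.dvd_add_iff_left h2]
  by_cases ha : p ∣ a <;> by_cases hb : p ∣ b
  · have : p ^ 2 ∣ a * b := by rw [pow_two]; exact mul_dvd_mul ha hb
    simp only [ha, hb, this, ha.mul_right b, if_true]
    norm_num
  · simp only [ha, hb, ha.mul_right b, if_true, if_false]
    split_ifs <;> norm_num
  · simp only [ha, hb, hb.mul_left a, if_true, if_false]
    split_ifs <;> norm_num
  · simp only [ha, hb, if_false]
    split_ifs <;> norm_num

theorem card_Ioc_dvd_le (d X : ℕ) :
    ((Finset.Ioc 0 X).filter (d ∣ ·)).card ≤ (X : ℝ) * (d : ℝ)⁻¹ := by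
  rw [Nat.Ioc_filter_dvd_card_eq_div, ← div_eq_mul_inv]
  exact Nat.cast_div_le

theorem divisorCount_eq_sum (s : Finset ℕ) (a : ℕ) :
    (divisorCount s a : ℝ) = ∑ p ∈ s, if p ∣ a then 1 else 0 := by
  simp [divisorCount]

theorem le_sum_divisorCount (s : Finset ℕ) (X : ℕ) :
    X * ∑ p ∈ s, (p : ℝ)⁻¹ - s.card ≤ ∑ a ∈ Finset.Ioc 0 X, (divisorCount s a : ℝ) := by
  simp only [divisorCount_eq_sum]
  rw [Finset.sum_comm, Finset.mul_sum, Finset.card_eq_sum_ones, Nat.cast_sum,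
    ← Finset.sum_sub_distrib]
  refine Finset.sum_le_sum fun p _ ↦ ?_
  rw [Finset.sum_boole, Nat.Ioc_filter_dvd_card_eq_div, ← div_eq_mul_inv]
  have := Nat.lt_floor_add_one ((X : ℝ) / p)
  rw [Nat.floor_div_eq_div] at this
  push_cast
  linarith

theorem sum_divisorCount_sq_le (s : Finset ℕ) (hs : ∀ p ∈ s, p.Prime) (X : ℕ) :
    ∑ a ∈ Finset.Ioc 0 X, (divisorCount s a : ℝ) ^ 2 ≤
      X * ((∑ p ∈ s, (p : ℝ)⁻¹) ^ 2 + ∑ p ∈ s, (p : ℝ)⁻¹) := by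
  have expand : ∑ a ∈ Finset.Ioc 0 X, (divisorCount s a : ℝ) ^ 2 =
      ∑ p ∈ s, ∑ q ∈ s, ∑ a ∈ Finset.Ioc 0 X, if p ∣ a ∧ q ∣ a then (1 : ℝ) else 0 := by
    simp only [divisorCount_eq_sum, pow_two, Finset.sum_mul_sum]
    rw [Finset.sum_comm]
    refine Finset.sum_congr rfl fun p _ ↦ ?_
    rw [Finset.sum_comm]
    refine Finset.sum_congr rfl fun q _ ↦ Finset.sum_congr rfl fun a _ ↦ ?_
    by_cases p ∣ a <;> by_cases q ∣ a <;> simp [*]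
  have bound : ∀ p ∈ s, ∀ q ∈ s,
      (∑ a ∈ Finset.Ioc 0 X, if p ∣ a ∧ q ∣ a then (1 : ℝ) else 0) ≤
        X * ((p : ℝ)⁻¹ * (q : ℝ)⁻¹ + if p = q then (p : ℝ)⁻¹ else 0) := by
    intro p hp q hq
    rw [Finset.sum_boole]
    by_cases hpq : p = q
    · subst hpq
      simp only [and_self, if_true]
      refine (card_Ioc_dvd_le p X).trans ?_
      gcongr
      have : (0 : ℝ) ≤ (p : ℝ)⁻¹ * (p : ℝ)⁻¹ := by positivity
      linarith
    · have hc := (Nat.coprime_primes (hs p hp) (hs q hq)).2 hpq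
      have : ∀ a, (p ∣ a ∧ q ∣ a) ↔ p * q ∣ a := fun a ↦
        ⟨fun h ↦ hc.mul_dvd_of_dvd_of_dvd h.1 h.2,
          fun h ↦ ⟨(dvd_mul_right p q).trans h, (dvd_mul_left q p).trans h⟩⟩
      simp only [this]
      refine (card_Ioc_dvd_le (p * q) X).trans ?_
      simp [hpq, mul_comm]
  rw [expand]
  refine (Finset.sum_le_sum fun p hp ↦ Finset.sum_le_sum fun q hq ↦ bound p hp q hq).trans ?_
  apply le_of_eq
  simp only [← Finset.mul_sum, Finset.sum_add_distrib]
  congr 2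
  · rw [pow_two, Finset.sum_mul]
  · exact Finset.sum_congr rfl fun p hp ↦ by simp [hp]

/-- The Turán–Kubilius inequality for the number of prime divisors in a finite set. -/
theorem sum_divisorCount_sub_sq_le (s : Finset ℕ) (hs : ∀ p ∈ s, p.Prime) (X : ℕ) :
    ∑ a ∈ Finset.Ioc 0 X, ((divisorCount s a : ℝ) - ∑ p ∈ s, (p : ℝ)⁻¹) ^ 2 ≤
      (X + 2 * s.card) * ∑ p ∈ s, (p : ℝ)⁻¹ := by
  have h1 := le_sum_divisorCount s X
  have h2 := sum_divisorCount_sq_le s hs X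
  have hS : 0 ≤ ∑ p ∈ s, (p : ℝ)⁻¹ := Finset.sum_nonneg fun p _ ↦ by positivity
  set S : ℝ := ∑ p ∈ s, (p : ℝ)⁻¹
  have expand : ∑ a ∈ Finset.Ioc 0 X, ((divisorCount s a : ℝ) - S) ^ 2 =
      ∑ a ∈ Finset.Ioc 0 X, (divisorCount s a : ℝ) ^ 2 -
        2 * S * ∑ a ∈ Finset.Ioc 0 X, (divisorCount s a : ℝ) + X * S ^ 2 := by
    simp only [sub_sq, Finset.sum_add_distrib, Finset.sum_sub_distrib, Finset.sum_const,
      Nat.card_Ioc, nsmul_eq_mul, Finset.mul_sum]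
    congr 2
    exact Finset.sum_congr rfl fun a _ ↦ by ring
  rw [expand]
  nlinarith [mul_le_mul_of_nonneg_left h1 hS]

/-- Most integers have at least `(1 - η) S` prime divisors in `s`, where `S = ∑ p ∈ s, 1 / p`. -/
theorem le_card_filter_divisorCount {s : Finset ℕ} (hs : ∀ p ∈ s, p.Prime) {n : ℕ}
    (hn : s.card ≤ n) {η : ℝ} (hη : 0 < η) (hS : 4 / η ^ 2 ≤ ∑ p ∈ s, (p : ℝ)⁻¹) :
    n ≤ {a ∈ Finset.Ioc 0 (2 * n) |
      (1 - η) * ∑ p ∈ s, (p : ℝ)⁻¹ ≤ (divisorCount s a : ℝ)}.card := by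
  have hvar := sum_divisorCount_sub_sq_le s hs (2 * n)
  set S : ℝ := ∑ p ∈ s, (p : ℝ)⁻¹
  have hS0 : 0 < S := lt_of_lt_of_le (by positivity) hS
  set bad := {a ∈ Finset.Ioc 0 (2 * n) | ¬ (1 - η) * S ≤ (divisorCount s a : ℝ)} with hbad
  have hbad_le : (bad.card : ℝ) * (η * S) ^ 2 ≤ (2 * n + 2 * n) * S := by
    calc (bad.card : ℝ) * (η * S) ^ 2 = ∑ a ∈ bad, (η * S) ^ 2 := by simp
      _ ≤ ∑ a ∈ bad, ((divisorCount s a : ℝ) - S) ^ 2 := by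
        refine Finset.sum_le_sum fun a ha ↦ ?_
        have := (Finset.mem_filter.1 ha).2
        push Not at this
        nlinarith [mul_pos hη hS0]
      _ ≤ ∑ a ∈ Finset.Ioc 0 (2 * n), ((divisorCount s a : ℝ) - S) ^ 2 :=
        Finset.sum_le_sum_of_subset_of_nonneg (Finset.filter_subset _ _)
          fun _ _ _ ↦ sq_nonneg _
      _ ≤ _ := hvar
      _ ≤ _ := by push_cast; gcongr
  have hbad_n : (bad.card : ℝ) ≤ n := by
    rw [div_le_iff₀ (by positivity)] at hS
    have h3 : (bad.card : ℝ) * 4 ≤ bad.card * (S * η ^ 2) := by gcongr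
    have h4 : (bad.card : ℝ) * (S * η ^ 2) * S ≤ 4 * n * S := by linarith
    have h5 := le_of_mul_le_mul_right h4 hS0
    linarith
  have hsum := Finset.card_filter_add_card_filter_not (s := Finset.Ioc 0 (2 * n))
    (fun a ↦ (1 - η) * S ≤ (divisorCount s a : ℝ))
  rw [Nat.card_Ioc] at hsum
  have : bad.card ≤ n := by exact_mod_cast hbad_n
  rw [hbad] at this
  omega

theorem sum_primesBelow_inv_sq_le (N : ℕ) : ∑ p ∈ N.primesBelow, ((p : ℝ) ^ 2)⁻¹ ≤ 1 := by
  calc ∑ p ∈ N.primesBelow, ((p : ℝ) ^ 2)⁻¹ ≤ ∑ p ∈ Finset.Ioo 1 N, ((p : ℝ) ^ 2)⁻¹ := by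
        refine Finset.sum_le_sum_of_subset_of_nonneg (fun p hp ↦ ?_) fun _ _ _ ↦ by positivity
        exact Finset.mem_Ioo.2 ⟨(Nat.prime_of_mem_primesBelow hp).one_lt,
          Nat.lt_of_mem_primesBelow hp⟩
    _ ≤ 2 / ((1 : ℕ) + 1) := sum_Ioo_inv_sq_le 1 N
    _ = 1 := by norm_num

theorem prod_primesBelow_le_exp (N : ℕ) :
    ∏ p ∈ N.primesBelow, (1 + (p : ℝ)⁻¹ + 2 * ((p : ℝ) ^ 2)⁻¹) ≤
      Real.exp (∑ p ∈ N.primesBelow, (p : ℝ)⁻¹ + 2) := by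
  calc ∏ p ∈ N.primesBelow, (1 + (p : ℝ)⁻¹ + 2 * ((p : ℝ) ^ 2)⁻¹)
      ≤ ∏ p ∈ N.primesBelow, Real.exp ((p : ℝ)⁻¹ + 2 * ((p : ℝ) ^ 2)⁻¹) := by
        refine Finset.prod_le_prod (fun p _ ↦ by positivity) fun p _ ↦ ?_
        linarith [Real.add_one_le_exp ((p : ℝ)⁻¹ + 2 * ((p : ℝ) ^ 2)⁻¹)]
    _ = Real.exp (∑ p ∈ N.primesBelow, (p : ℝ)⁻¹ + 2 * ∑ p ∈ N.primesBelow, ((p : ℝ) ^ 2)⁻¹) := by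
        rw [← Real.exp_sum, Finset.sum_add_distrib, Finset.mul_sum]
    _ ≤ _ := by
        gcongr
        linarith [sum_primesBelow_inv_sq_le N]

theorem log_le_prod_primesBelow {N : ℕ} (hN : 0 < N) :
    Real.log N ≤ ∏ p ∈ N.primesBelow, (1 - (p : ℝ)⁻¹)⁻¹ := by
  let f : ℕ →* ℝ :=
    ((invMonoidWithZeroHom (G₀ := ℝ)).comp (Nat.castRingHom ℝ).toMonoidWithZeroHom).toMonoidHom
  have hf : ∀ k : ℕ, f k = (k : ℝ)⁻¹ := fun _ ↦ rfl
  have h := EulerProduct.summable_and_hasSum_smoothNumbers_prod_primesBelow_geometric (f := f)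
    (fun {p} hp ↦ by
      rw [hf, norm_inv, Real.norm_natCast]
      exact inv_lt_one_of_one_lt₀ (by exact_mod_cast hp.one_lt)) N
  simp only [hf] at h
  have hlog := log_add_one_le_harmonic (N - 1)
  rw [harmonic_eq_sum_Icc, Nat.sub_add_cancel hN] at hlog
  push_cast at hlog
  refine hlog.trans ?_
  rw [← h.2.tsum_eq]
  have hmem : ∀ k ∈ Finset.Icc 1 (N - 1), k ∈ N.smoothNumbers := fun k hk ↦ by
    rw [Finset.mem_Icc] at hk
    exact Nat.mem_smoothNumbers_of_lt hk.1 (by omega)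
  rw [← Finset.sum_subtype_of_mem (fun k : ℕ ↦ (k : ℝ)⁻¹) hmem]
  exact h.2.summable.sum_le_tsum _ fun k _ ↦ by positivity

/-- A lower bound of Mertens type for the sum of the reciprocals of the primes. -/
theorem log_le_exp_sum_primesBelow_inv {N : ℕ} (hN : 0 < N) :
    Real.log N ≤ Real.exp (∑ p ∈ N.primesBelow, (p : ℝ)⁻¹ + 2) := by
  refine (log_le_prod_primesBelow hN).trans (le_trans ?_ (prod_primesBelow_le_exp N))
  have hp2 : ∀ p ∈ N.primesBelow, (p : ℝ)⁻¹ ≤ 2⁻¹ := fun p hp ↦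
    inv_anti₀ two_pos (by exact_mod_cast (Nat.prime_of_mem_primesBelow hp).two_le)
  refine Finset.prod_le_prod (fun p hp ↦ ?_) fun p hp ↦ ?_
  · have := hp2 p hp
    exact inv_nonneg.2 (by linarith)
  · have h := hp2 p hp
    have h0 : (0 : ℝ) ≤ (p : ℝ)⁻¹ := by positivity
    rw [← inv_pow]
    set u := (p : ℝ)⁻¹
    rw [inv_le_iff_one_le_mul₀ (by linarith)]
    nlinarith [mul_nonneg (sq_nonneg u) (by linarith : 0 ≤ 1 - 2 * u)]

theorem card_mul_two_rpow_le {s : Finset ℕ} (hs : ∀ p ∈ s, p.Prime) {m : ℕ}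
    (hm : ∀ p ∈ s, p ^ 2 ∣ m) {A : Finset ℕ} {T : ℝ} (hT : ∀ a ∈ A, T ≤ divisorCount s a) {Z : ℕ}
    (hZ : ∀ a ∈ A, ∀ b ∈ A, ∀ c ∈ A, a * b + m * c ∈ Finset.Ioc 0 Z) :
    (((A ×ˢ A ×ˢ A).image (fun p : ℕ × ℕ × ℕ => p.1 * p.2.1 + m * p.2.2)).card : ℝ) *
        2 ^ (2 * T) ≤ Z * ∏ p ∈ s, (1 + (p : ℝ)⁻¹ + 2 * ((p : ℝ) ^ 2)⁻¹) := by
  refine le_trans ?_ (sum_truncatedWeight_le s hs Z)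
  rw [← nsmul_eq_mul, ← Finset.sum_const]
  refine (Finset.sum_le_sum fun x hx ↦ ?_).trans
    (Finset.sum_le_sum_of_subset_of_nonneg (fun x hx ↦ ?_) fun x _ _ ↦ truncatedWeight_nonneg s x)
  · obtain ⟨⟨a, b, c⟩, habc, rfl⟩ := Finset.mem_image.1 hx
    simp only [Finset.mem_product] at habc
    refine le_trans ?_ (two_pow_le_truncatedWeight hm a b c)
    rw [← Real.rpow_natCast]
    refine Real.rpow_le_rpow_of_exponent_le one_le_two ?_
    push_cast
    linarith [hT a habc.1, hT b habc.2.1]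
  · obtain ⟨⟨a, b, c⟩, habc, rfl⟩ := Finset.mem_image.1 hx
    simp only [Finset.mem_product] at habc
    exact hZ a habc.1 b habc.2.1 c habc.2.2

theorem exists_card_image_mul_two_rpow_le {N n : ℕ} (hN : N ≤ n) (hNn : 16 ^ (N - 1) ≤ n)
    {η : ℝ} (hη : 0 < η) (hS : 4 / η ^ 2 ≤ ∑ p ∈ N.primesBelow, (p : ℝ)⁻¹) :
    ∃ A : Finset ℕ, ∃ m : ℕ, A.card = n ∧ (∀ a ∈ A, 0 < a) ∧ 0 < m ∧
      (((A ×ˢ A ×ˢ A).image (fun p : ℕ × ℕ × ℕ => p.1 * p.2.1 + m * p.2.2)).card : ℝ) *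
          2 ^ (2 * ((1 - η) * ∑ p ∈ N.primesBelow, (p : ℝ)⁻¹)) ≤
        6 * n ^ 2 * Real.exp (∑ p ∈ N.primesBelow, (p : ℝ)⁻¹ + 2) := by
  have hs : ∀ p ∈ N.primesBelow, p.Prime := fun p hp ↦ Nat.prime_of_mem_primesBelow hp
  have hcard : N.primesBelow.card ≤ n := by
    refine le_trans ?_ hN
    exact (Finset.card_le_card (Finset.filter_subset Nat.Prime (Finset.range N))).trans_eq
      (Finset.card_range N)
  obtain ⟨A, hA, hAn⟩ := Finset.exists_subset_card_eq (le_card_filter_divisorCount hs hcard hη hS)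
  have hA' : ∀ a ∈ A, 0 < a ∧ a ≤ 2 * n := fun a ha ↦
    Finset.mem_Ioc.1 (Finset.mem_filter.1 (hA ha)).1
  set m := (primorial (N - 1)) ^ 2 with hm
  have hm0 : 0 < m := pow_pos (primorial_pos _) 2
  have hmn : m ≤ n := by
    calc m ≤ (4 ^ (N - 1)) ^ 2 := Nat.pow_le_pow_left (primorial_le_four_pow _) 2
      _ = 16 ^ (N - 1) := by rw [← pow_mul, mul_comm, pow_mul]; norm_num
      _ ≤ n := hNn
  refine ⟨A, m, hAn, fun a ha ↦ (hA' a ha).1, hm0, ?_⟩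
  refine (card_mul_two_rpow_le hs (fun p hp ↦ ?_) (fun a ha ↦ (Finset.mem_filter.1 (hA ha)).2)
    (Z := 6 * n ^ 2) fun a ha b hb c hc ↦ ?_).trans ?_
  · refine pow_dvd_pow_of_dvd ((hs p hp).dvd_primorial_iff.2 ?_) 2
    have := Nat.lt_of_mem_primesBelow hp
    omega
  · obtain ⟨ha0, ha⟩ := hA' a ha
    obtain ⟨hb0, hb⟩ := hA' b hb
    obtain ⟨hc0, hc⟩ := hA' c hc
    refine Finset.mem_Ioc.2 ⟨by positivity, ?_⟩
    calc a * b + m * c ≤ (2 * n) * (2 * n) + n * (2 * n) := by gcongr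
      _ = 6 * n ^ 2 := by ring
  · push_cast
    gcongr
    exact prod_primesBelow_le_exp N

theorem card_image_Icc_le (n : ℕ) (hn : 0 < n) :
    (((Finset.Icc 1 n ×ˢ Finset.Icc 1 n ×ˢ Finset.Icc 1 n).image
      (fun p : ℕ × ℕ × ℕ => p.1 * p.2.1 + 1 * p.2.2)).card : ℝ) ≤ 2 * n ^ 2 := by
  have hsub : (Finset.Icc 1 n ×ˢ Finset.Icc 1 n ×ˢ Finset.Icc 1 n).image
      (fun p : ℕ × ℕ × ℕ => p.1 * p.2.1 + 1 * p.2.2) ⊆ Finset.Ioc 0 (2 * n ^ 2) := by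
    intro x hx
    obtain ⟨⟨a, b, c⟩, habc, rfl⟩ := Finset.mem_image.1 hx
    simp only [Finset.mem_product, Finset.mem_Icc] at habc
    obtain ⟨⟨ha0, ha⟩, ⟨hb0, hb⟩, hc0, hc⟩ := habc
    refine Finset.mem_Ioc.2 ⟨by positivity, ?_⟩
    calc a * b + 1 * c ≤ n * n + n * n := by gcongr; exact hn
      _ = 2 * n ^ 2 := by ring
  have := Finset.card_le_card hsub
  rw [Nat.card_Ioc] at this
  exact_mod_cast this

theorem log_log_le_three_mul_log {n : ℕ} (hn : 16 ≤ n) :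
    Real.log (Real.log n) ≤ 3 * Real.log (Nat.log 16 n + 1 : ℕ) := by
  have hn0 : (0 : ℝ) < n := by positivity
  have hN : 2 ≤ Nat.log 16 n + 1 := by
    have := Nat.log_pos (by norm_num) hn
    omega
  have hlt := Nat.lt_pow_succ_log_self (b := 16) (by norm_num) n
  rw [Nat.succ_eq_add_one] at hlt
  generalize Nat.log 16 n + 1 = N at hN hlt
  have hN' : (2 : ℝ) ≤ N := by exact_mod_cast hN
  have hlog16 : Real.log 16 ≤ 4 := by
    rw [show (16 : ℝ) = 2 ^ 4 by norm_num, Real.log_pow]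
    push_cast
    linarith [Real.log_two_lt_d9]
  have h1 : Real.log n ≤ (N : ℝ) ^ 3 := by
    calc Real.log n ≤ Real.log ((16 : ℝ) ^ N) := Real.log_le_log hn0 (by exact_mod_cast hlt.le)
      _ = N * Real.log 16 := Real.log_pow _ _
      _ ≤ N * 4 := by gcongr
      _ ≤ (N : ℝ) ^ 3 := by
        nlinarith [mul_nonneg (by linarith : (0 : ℝ) ≤ N) (sq_nonneg ((N : ℝ) - 2))]
  have hlog0 : 0 < Real.log n := Real.log_pos (by exact_mod_cast (by omega : 1 < n))
  calc Real.log (Real.log n) ≤ Real.log ((N : ℝ) ^ 3) := Real.log_le_log hlog0 h1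
    _ = 3 * Real.log N := by rw [Real.log_pow]; norm_num

theorem one_le_log_log {n : ℕ} (hn : 16 ≤ n) : 1 ≤ Real.log (Real.log n) := by
  have h1 : Real.exp 1 ≤ Real.log n := by
    calc Real.exp 1 ≤ 4 * Real.log 2 := by linarith [Real.exp_one_lt_d9, Real.log_two_gt_d9]
      _ = Real.log 16 := by
        rw [show (16 : ℝ) = 2 ^ 4 by norm_num, Real.log_pow]
        norm_num
      _ ≤ Real.log n := Real.log_le_log (by norm_num) (by exact_mod_cast hn)
  rwa [Real.le_log_iff_exp_le (lt_of_lt_of_le (Real.exp_pos 1) h1)]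

theorem exp_bound_of_le_exp {S L η e : ℝ} (hη0 : 0 < η) (hη : η ≤ 1 / 4)
    (he : 1 - 2 * Real.log 2 + 2 * Real.log 2 * η ≤ e) (hL : 1 ≤ L)
    (hLS : L ≤ 3 * Real.exp (S + 2)) :
    Real.exp (S + 2) ≤ Real.exp 6 * L ^ e * 2 ^ (2 * ((1 - η) * S)) := by
  have hl0 : 0 ≤ Real.log L := Real.log_nonneg hL
  have hl : Real.log L ≤ 2 + (S + 2) := by
    calc Real.log L ≤ Real.log (3 * Real.exp (S + 2)) := Real.log_le_log (by linarith) hLS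
      _ = Real.log 3 + (S + 2) := by
        rw [Real.log_mul (by norm_num) (Real.exp_ne_zero _), Real.log_exp]
      _ ≤ _ := by
        gcongr
        linarith [Real.log_le_sub_one_of_pos (show (0 : ℝ) < 3 by norm_num)]
  rw [Real.rpow_def_of_pos (by linarith), Real.rpow_def_of_pos two_pos, ← Real.exp_add,
    ← Real.exp_add]
  refine Real.exp_le_exp.2 ?_
  have hgt := Real.log_two_gt_d9
  have hlt := Real.log_two_lt_d9
  set α : ℝ := 2 * Real.log 2 * (1 - η) - 1 with hα
  have hα0 : 0 ≤ α := by nlinarith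
  have hα1 : α ≤ 1 := by nlinarith
  have h1 : Real.log L * -α ≤ Real.log L * e := mul_le_mul_of_nonneg_left (by linarith) hl0
  have h2 : α * Real.log L ≤ α * (2 + (S + 2)) := mul_le_mul_of_nonneg_left hl hα0
  have h3 : Real.log 2 * (2 * ((1 - η) * S)) = (α + 1) * S := by rw [hα]; ring
  rw [h3]
  linarith


/-- For every `ε > 0` there is `C > 0` such that for every integer `n ≥ 16` there exist a
set `A` of `n` positive integers and a positive integer `m` with
`|AA + mA| ≤ C·n²·(log log n)^(1 − 2·ln 2 + ε)`. -/
theorem exists_small_AA_add_mA :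
    ∀ ε : ℝ, 0 < ε → ∃ C : ℝ, 0 < C ∧ ∀ n : ℕ, 16 ≤ n →
      ∃ A : Finset ℕ, ∃ m : ℕ,
        A.card = n ∧ (∀ a ∈ A, 0 < a) ∧ 0 < m ∧
        (((A ×ˢ A ×ˢ A).image
            (fun p : ℕ × ℕ × ℕ => p.1 * p.2.1 + m * p.2.2)).card : ℝ) ≤
          C * (n : ℝ) ^ 2 *
            (Real.log (Real.log (n : ℝ))) ^ (1 - 2 * Real.log 2 + ε) := by
  intro ε hε
  set η : ℝ := min (ε / 2) (1 / 4) with hη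
  have hη0 : 0 < η := lt_min (by linarith) (by norm_num)
  have hη4 : η ≤ 1 / 4 := min_le_right _ _
  have hηε : η ≤ ε / 2 := min_le_left _ _
  set B : ℝ := 3 * Real.exp (4 / η ^ 2 + 2) with hB
  have hB0 : 0 < B := by positivity
  have hlt := Real.log_two_lt_d9
  have hgt := Real.log_two_gt_d9
  set e : ℝ := 1 - 2 * Real.log 2 + ε with he
  refine ⟨6 * Real.exp 6 + 2 * B, by positivity, fun n hn ↦ ?_⟩
  set N := Nat.log 16 n + 1 with hN
  set S : ℝ := ∑ p ∈ N.primesBelow, (p : ℝ)⁻¹ with hS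
  have hL1 := one_le_log_log hn
  have hLS : Real.log (Real.log n) ≤ 3 * Real.exp (S + 2) := by
    have := log_le_exp_sum_primesBelow_inv (N := N) (Nat.succ_pos _)
    linarith [log_log_le_three_mul_log hn]
  set L : ℝ := Real.log (Real.log n)
  have hL0 : 0 < L := by linarith
  by_cases hlarge : 4 / η ^ 2 ≤ S
  · have hpow : 16 ^ (N - 1) ≤ n := Nat.pow_log_le_self 16 (by omega)
    have hNn : N ≤ n := Nat.succ_le_of_lt (Nat.log_lt_self 16 (by omega))
    obtain ⟨A, m, hAn, hA0, hm0, hcard⟩ := exists_card_image_mul_two_rpow_le hNn hpow hη0 hlarge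
    refine ⟨A, m, hAn, hA0, hm0, ?_⟩
    have hexp := exp_bound_of_le_exp hη0 hη4 (e := e) (by nlinarith) hL1 hLS
    have hcard' := hcard.trans
      (mul_le_mul_of_nonneg_left hexp (by positivity : 0 ≤ 6 * (n : ℝ) ^ 2))
    rw [← hS, ← mul_assoc (6 * (n : ℝ) ^ 2)] at hcard'
    refine (le_of_mul_le_mul_right hcard' (by positivity)).trans ?_
    have : 0 ≤ 2 * B * (n : ℝ) ^ 2 * L ^ e := by positivity
    linarith
  · refine ⟨Finset.Icc 1 n, 1, by simp, fun a ha ↦ (Finset.mem_Icc.1 ha).1, one_pos, ?_⟩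
    refine (card_image_Icc_le n (by omega)).trans ?_
    have hLB : L ≤ B := hLS.trans (by rw [hB]; gcongr; exact (not_le.1 hlarge).le)
    have hBL : 1 ≤ B * L ^ e := by
      calc (1 : ℝ) = L * L ^ (-1 : ℝ) := by rw [Real.rpow_neg_one, mul_inv_cancel₀ hL0.ne']
        _ ≤ B * L ^ e := by
          gcongr
          linarith
    have h1 : 0 ≤ 6 * Real.exp 6 * (n : ℝ) ^ 2 * L ^ e := by positivity
    have h2 := mul_le_mul_of_nonneg_left hBL (by positivity : 0 ≤ 2 * (n : ℝ) ^ 2)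
    linarith
end
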